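/- Let F be a field of characteristic p > 0, G ⊆ SL(3, F) a finite subgroup, and V = F³ = Fv ⊕ W a direct sum of G-submodules with dim_F W = 2. Suppose T(G) ≠ 1 and W is a reducible T(G)-module. Then there is a basis {x₁, x₂} of W with respect to which T(G)|_W consists of unipotent upper triangular matrices and is elementary abelian of order p^n, and S(V)^G is Gorenstein if and only if for every g ∈ G the matrix of g|_W with respect to {x₁, x₂} is upper triangular, (a b; 0 d), with a^{p^n − 1} = 1. -/

import Mathlib

noncomputable section
open CategoryTheory Matrix MvPolynomial

universe u

/-- A module `M` over `R` has finite injective dimension iff the Ext functors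
`Ext^i(-, M)` vanish for all sufficiently large `i`. -/
def HasFiniteInjectiveDimension (R : Type u) [CommRing R] (M : ModuleCat.{u} R) : Prop :=
  ∃ n : ℕ, ∀ (N : ModuleCat.{u} R) (i : ℕ), n < i →
    Subsingleton (((Ext R (ModuleCat.{u} R) i).obj (Opposite.op N)).obj M)

/-- A commutative ring is Gorenstein if it is Noetherian and its localization at every
prime ideal has finite injective dimension over itself. -/
def IsGorensteinRing (R : Type u) [CommRing R] : Prop :=
  IsNoetherianRing R ∧ ∀ (P : Ideal R) [P.IsPrime],
    HasFiniteInjectiveDimension (Localization.AtPrime P)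
      (ModuleCat.of (Localization.AtPrime P) (Localization.AtPrime P))

/-- The substitution action of a matrix on polynomials: `X i ↦ ∑ j, M i j • X j`. -/
def polyAct {F : Type u} [CommSemiring F] {m : ℕ} (M : Matrix (Fin m) (Fin m) F) :
    MvPolynomial (Fin m) F →ₐ[F] MvPolynomial (Fin m) F :=
  MvPolynomial.aeval fun i => ∑ j, M i j • MvPolynomial.X j

/-- The subalgebra of polynomials invariant under a set of matrices. -/
def invariantAlg {F : Type u} [CommSemiring F] {m : ℕ} (S : Set (Matrix (Fin m) (Fin m) F)) :
    Subalgebra F (MvPolynomial (Fin m) F) where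
  carrier := {f | ∀ M ∈ S, polyAct M f = f}
  mul_mem' := fun hf hg => fun M hM => by rw [_root_.map_mul, hf M hM, hg M hM]
  add_mem' := fun hf hg => fun M hM => by rw [_root_.map_add, hf M hM, hg M hM]
  algebraMap_mem' := fun r => fun M hM => (polyAct M).commutes r

/-- The invariant ring `S(V)^G` for a subgroup `G` of `SL(m, F)`, where `S(V)` is realised
as the polynomial ring `F[X 0, …, X (m-1)]`. -/
def invariantRing {F : Type u} [Field F] {m : ℕ}
    (G : Subgroup (Matrix.SpecialLinearGroup (Fin m) F)) :
    Subalgebra F (MvPolynomial (Fin m) F) :=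
  invariantAlg {M | ∃ g ∈ G, (g : Matrix (Fin m) (Fin m) F) = M}

/-- A matrix `M` is a transvection if `rank (M - 1) = 1` and `(M - 1)² = 0`. -/
def IsTransvectionMat {F : Type u} [Field F] {m : ℕ} (M : Matrix (Fin m) (Fin m) F) : Prop :=
  (M - 1).rank = 1 ∧ (M - 1) * (M - 1) = 0

/-- `T(G)`: the subgroup generated by all transvections contained in `G`. -/
def transSubgroup {F : Type u} [Field F] {m : ℕ}
    (G : Subgroup (Matrix.SpecialLinearGroup (Fin m) F)) :
    Subgroup (Matrix.SpecialLinearGroup (Fin m) F) :=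
  Subgroup.closure {g | g ∈ G ∧ IsTransvectionMat (g : Matrix (Fin m) (Fin m) F)}

/-- The matrix of the restriction `g|W` of `g` to the coordinate plane
`W = span {e 1, e 2}` (with respect to the standard basis `{e 1, e 2}` of `W`). -/
def subW {F : Type u} [Field F] (g : Matrix.SpecialLinearGroup (Fin 3) F) :
    Matrix (Fin 2) (Fin 2) F :=
  Matrix.submatrix (g : Matrix (Fin 3) (Fin 3) F) Fin.succ Fin.succ

/-- The matrix of `g|W` with respect to the basis of `W = span {e 1, e 2}` encoded by the
invertible change-of-basis matrix `P`. -/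
def restrictW {F : Type u} [Field F] (P : (Matrix (Fin 2) (Fin 2) F)ˣ)
    (g : Matrix.SpecialLinearGroup (Fin 3) F) : Matrix (Fin 2) (Fin 2) F :=
  (↑P⁻¹ : Matrix (Fin 2) (Fin 2) F) * subW g * (↑P : Matrix (Fin 2) (Fin 2) F)

lemma subsingleton_legacyExt_iff {R : Type u} [CommRing R] (N M : ModuleCat.{u} R) (n : ℕ) :
    Subsingleton (((Ext R (ModuleCat.{u} R) (n + 1)).obj (Opposite.op N)).obj M) ↔
      Subsingleton (Abelian.Ext N M (n + 1)) := by
  let Q := projectiveResolution N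
  have h1 : Subsingleton (((Ext R (ModuleCat.{u} R) (n + 1)).obj (Opposite.op N)).obj M) ↔
      ∀ f : Q.complex.X (n + 1) ⟶ M, Q.complex.d (n + 2) (n + 1) ≫ f = 0 →
        ∃ g : Q.complex.X n ⟶ M, Q.complex.d (n + 1) n ≫ g = f := by
    rw [(Q.isoExt (R := R) (n + 1) M).toLinearEquiv.toEquiv.subsingleton_congr,
      ← ModuleCat.isZero_iff_subsingleton, ← HomologicalComplex.exactAt_iff_isZero_homology,
      HomologicalComplex.exactAt_iff' _ n (n + 1) (n + 2) (by simp) (by simp),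
      ShortComplex.moduleCat_exact_iff]
    exact Iff.rfl
  rw [h1]
  constructor
  · intro h
    refine ⟨fun a b => ?_⟩
    suffices H : ∀ a : Abelian.Ext N M (n + 1), a = 0 by rw [H a, H b]
    intro a
    obtain ⟨f, hf, rfl⟩ := Q.extMk_surjective a (n + 2) rfl
    exact (Q.extMk_eq_zero_iff f _ rfl hf n rfl).2 (h f hf)
  · intro h f hf
    exact (Q.extMk_eq_zero_iff f _ rfl hf n rfl).1 (Subsingleton.elim _ _)

lemma hasFiniteInjectiveDimension_iff {R : Type u} [CommRing R] (M : ModuleCat.{u} R) :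
    HasFiniteInjectiveDimension R M ↔ ∃ n, HasInjectiveDimensionLE M n := by
  constructor
  · rintro ⟨n, hn⟩
    exact ⟨n, hasInjectiveDimensionLT_of_enoughProjectives M (n + 1) fun Y =>
      (subsingleton_legacyExt_iff Y M n).1 (hn Y (n + 1) (Nat.lt_succ_self n))⟩
  · rintro ⟨n, hn⟩
    refine ⟨n, fun N i hi => ?_⟩
    obtain ⟨i, rfl⟩ : ∃ j, i = j + 1 := ⟨i - 1, by omega⟩
    exact (subsingleton_legacyExt_iff N M i).2 (HasInjectiveDimensionLT.subsingleton M (n + 1) _ hi N)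

section dimension
variable {R : Type u} [CommRing R] {K L M : Type u} [AddCommGroup K] [AddCommGroup L]
  [AddCommGroup M] [Module R K] [Module R L] [Module R M]

lemma exists_shortExact (f : K →ₗ[R] L) (g : L →ₗ[R] M) (hf : Function.Injective f)
    (hfg : Function.Exact f g) (hg : Function.Surjective g) :
    ∃ S : ShortComplex (ModuleCat.{u} R), S.ShortExact ∧ S.X₁ = ModuleCat.of R K ∧
      S.X₂ = ModuleCat.of R L ∧ S.X₃ = ModuleCat.of R M :=
  ⟨ModuleCat.shortComplexOfCompEqZero f g hfg.linearMap_comp_eq_zero,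
    ModuleCat.shortComplex_shortExact _ hfg hf hg, rfl, rfl, rfl⟩

lemma projectiveDimensionLE_zero_iff :
    HasProjectiveDimensionLE (ModuleCat.of R M) 0 ↔ Module.Projective R M := by
  rw [HasProjectiveDimensionLE, zero_add, ← projective_iff_hasProjectiveDimensionLT_one,
    ← IsProjective.iff_projective]

lemma injectiveDimensionLE_zero_iff :
    HasInjectiveDimensionLE (ModuleCat.of R M) 0 ↔ Module.Injective R M := by
  rw [HasInjectiveDimensionLE, zero_add, ← injective_iff_hasInjectiveDimensionLT_one,
    ← Module.injective_iff_injective_object]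

lemma projectiveDimensionLE_succ_iff (f : K →ₗ[R] L) (g : L →ₗ[R] M) (hf : Function.Injective f)
    (hfg : Function.Exact f g) (hg : Function.Surjective g) [Module.Projective R L] (n : ℕ) :
    HasProjectiveDimensionLE (ModuleCat.of R M) (n + 1) ↔
      HasProjectiveDimensionLE (ModuleCat.of R K) n := by
  obtain ⟨S, hS, h1, h2, h3⟩ := exists_shortExact f g hf hfg hg
  have := hS.hasProjectiveDimensionLT_X₃_iff n
    (h2 ▸ (IsProjective.iff_projective L).1 inferInstance)
  rwa [h1, h3] at this

lemma projectiveDimensionLE_succ_of_exact (f : K →ₗ[R] L) (g : L →ₗ[R] M)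
    (hf : Function.Injective f) (hfg : Function.Exact f g) (hg : Function.Surjective g) (n : ℕ)
    (hK : HasProjectiveDimensionLE (ModuleCat.of R K) n)
    (hL : HasProjectiveDimensionLE (ModuleCat.of R L) n) :
    HasProjectiveDimensionLE (ModuleCat.of R M) (n + 1) := by
  obtain ⟨S, hS, h1, h2, h3⟩ := exists_shortExact f g hf hfg hg
  rw [← h3]
  rw [← h1] at hK
  rw [← h2] at hL
  exact hS.hasProjectiveDimensionLT_X₃ (n + 1) hK
    (hasProjectiveDimensionLT_of_ge _ (n + 1) _ (by omega))

lemma injectiveDimensionLE_succ_iff (f : K →ₗ[R] L) (g : L →ₗ[R] M) (hf : Function.Injective f)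
    (hfg : Function.Exact f g) (hg : Function.Surjective g) [Module.Injective R L] (n : ℕ) :
    HasInjectiveDimensionLE (ModuleCat.of R K) (n + 1) ↔
      HasInjectiveDimensionLE (ModuleCat.of R M) n := by
  obtain ⟨S, hS, h1, h2, h3⟩ := exists_shortExact f g hf hfg hg
  have := hS.hasInjectiveDimensionLT_X₃_iff n
    (h2 ▸ (Module.injective_iff_injective_object R L).1 inferInstance)
  rw [h1, h3] at this
  exact this.symm

lemma exists_injective_embedding (M : Type u) [AddCommGroup M] [Module R M] :
    ∃ (E : Type u) (_ : AddCommGroup E) (_ : Module R E) (_ : Module.Injective R E)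
      (f : M →ₗ[R] E), Function.Injective f := by
  obtain ⟨I, hI, f, hf⟩ := EnoughInjectives.presentation (ModuleCat.of R M)
  exact ⟨I, inferInstance, inferInstance, Module.injective_module_of_injective_object R I, f.hom,
    (ModuleCat.mono_iff_injective f).1 hf⟩

end dimension

open TensorProduct in
lemma projectiveDimensionLE_tensor {A B : Type u} [CommRing A] [CommRing B] [Algebra A B]
    [Module.Flat A B] (n : ℕ) (M : Type u) [AddCommGroup M] [Module A M]
    (h : HasProjectiveDimensionLE (ModuleCat.of A M) n) :
    HasProjectiveDimensionLE (ModuleCat.of B (B ⊗[A] M)) n := by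
  induction n generalizing M with
  | zero =>
    rw [projectiveDimensionLE_zero_iff] at h ⊢
    infer_instance
  | succ n ih =>
    let f : (M →₀ A) →ₗ[A] M := Finsupp.linearCombination A id
    have hf : Function.Surjective f := Finsupp.linearCombination_id_surjective A M
    have ex : Function.Exact (LinearMap.ker f).subtype f := LinearMap.exact_subtype_ker_map f
    have hK := (projectiveDimensionLE_succ_iff _ f (Submodule.subtype_injective _) ex hf n).1 h
    refine (projectiveDimensionLE_succ_iff ((LinearMap.ker f).subtype.baseChange B)
      (f.baseChange B) ?_ ?_ ?_ n).2 (ih _ hK)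
    · exact Module.Flat.lTensor_preserves_injective_linearMap (M := B) _
        (Submodule.subtype_injective _)
    · have h2 := @Module.Flat.lTensor_exact A B _ _ _ _ (LinearMap.ker f) (M →₀ A) M _ _ _ _ _ _
        (LinearMap.ker f).subtype f ex
      exact h2
    · exact LinearMap.lTensor_surjective B hf

section polynomial
open TensorProduct Polynomial

lemma tensor_ext_X {A : Type*} [CommRing A] {M N : Type*} [AddCommGroup M]
    [Module A M] [AddCommGroup N] [Module A N] {f g : A[X] ⊗[A] M →ₗ[A] N}
    (h : ∀ k m, f ((Polynomial.X ^ k) ⊗ₜ m) = g ((Polynomial.X ^ k) ⊗ₜ m)) : f = g := by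
  refine TensorProduct.ext ((Polynomial.basisMonomials A).ext fun k => LinearMap.ext fun m => ?_)
  simpa [Polynomial.monomial_one_right_eq_X_pow] using h k m

variable {A : Type u} [CommRing A] (M : Type u) [AddCommGroup M] [Module A M] [Module A[X] M]
  [IsScalarTower A A[X] M]

/-- The `A[X]`-linear endomorphism `X ⊗ 1 - 1 ⊗ X` of `A[X] ⊗ M`. -/
def polyKoszulMap : A[X] ⊗[A] M →ₗ[A[X]] A[X] ⊗[A] M :=
  LinearMap.lsmul A[X] _ (Polynomial.X : A[X]) -
    (Algebra.lsmul A A M (Polynomial.X : A[X])).baseChange A[X]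

/-- The `A[X]`-linear action map `A[X] ⊗ M → M`. -/
def polyActionMap : A[X] ⊗[A] M →ₗ[A[X]] M :=
  AlgebraTensorModule.lift ((LinearMap.lsmul A[X] M).restrictScalars₁₂ A[X] A)

/-- The `A`-linear maps `m ↦ ∑ i < k, X ^ i ⊗ X ^ (k - 1 - i) m`. -/
def polyHomotopyAux : ℕ → (M →ₗ[A] A[X] ⊗[A] M)
  | 0 => 0
  | k + 1 => TensorProduct.mk A A[X] M (Polynomial.X ^ k) +
      (polyHomotopyAux k).comp (Algebra.lsmul A A M (Polynomial.X : A[X]))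

/-- A contracting homotopy of the complex `A[X] ⊗ M → A[X] ⊗ M → M`. -/
def polyHomotopy : A[X] ⊗[A] M →ₗ[A] A[X] ⊗[A] M :=
  TensorProduct.lift ((Polynomial.basisMonomials A).constr A (polyHomotopyAux M))

variable {M}

lemma polyHomotopy_tmul (k : ℕ) (m : M) :
    polyHomotopy M ((Polynomial.X ^ k : A[X]) ⊗ₜ[A] m) = polyHomotopyAux M k m := by
  have := (Polynomial.basisMonomials A).constr_basis A (polyHomotopyAux (A := A) M) k
  simp only [Polynomial.coe_basisMonomials, Polynomial.monomial_one_right_eq_X_pow] at this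
  simp [polyHomotopy, this]

lemma polyKoszulMap_tmul (f : A[X]) (m : M) :
    polyKoszulMap M (f ⊗ₜ[A] m) = (Polynomial.X * f) ⊗ₜ m - f ⊗ₜ ((Polynomial.X : A[X]) • m) := by
  simp [polyKoszulMap, smul_tmul']

lemma polyActionMap_tmul (f : A[X]) (m : M) : polyActionMap M (f ⊗ₜ[A] m) = f • m := by
  simp [polyActionMap]

lemma polyHomotopy_polyKoszulMap (t : A[X] ⊗[A] M) : polyHomotopy M (polyKoszulMap M t) = t := by
  suffices (polyHomotopy M).comp ((polyKoszulMap M).restrictScalars A) = LinearMap.id from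
    LinearMap.congr_fun this t
  refine tensor_ext_X fun k m => ?_
  simp only [LinearMap.comp_apply, LinearMap.restrictScalars_apply, polyKoszulMap_tmul, map_sub,
    ← pow_succ', polyHomotopy_tmul, polyHomotopyAux]
  simp

lemma polyKoszulMap_polyHomotopy (t : A[X] ⊗[A] M) :
    polyKoszulMap M (polyHomotopy M t) = t - 1 ⊗ₜ polyActionMap M t := by
  suffices ((polyKoszulMap M).restrictScalars A).comp (polyHomotopy M) =
      LinearMap.id - (TensorProduct.mk A A[X] M 1).comp ((polyActionMap M).restrictScalars A) from
    LinearMap.congr_fun this t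
  refine tensor_ext_X fun k m => ?_
  simp only [LinearMap.comp_apply, LinearMap.restrictScalars_apply, LinearMap.sub_apply,
    LinearMap.id_apply, polyHomotopy_tmul, polyActionMap_tmul, TensorProduct.mk_apply]
  induction k generalizing m with
  | zero => simp [polyHomotopyAux]
  | succ k ih =>
    have := ih ((Polynomial.X : A[X]) • m)
    simp only [polyHomotopyAux, LinearMap.add_apply, map_add, LinearMap.comp_apply,
      Algebra.lsmul_coe, this, TensorProduct.mk_apply, polyKoszulMap_tmul, smul_smul, ← pow_succ,
      ← pow_succ']
    abel

lemma projectiveDimensionLE_polynomial {n : ℕ}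
    (h : ∀ (M : Type u) [AddCommGroup M] [Module A M],
      HasProjectiveDimensionLE (ModuleCat.of A M) n) (M : Type u) [AddCommGroup M]
    [Module A[X] M] : HasProjectiveDimensionLE (ModuleCat.of A[X] M) (n + 1) := by
  let _ : Module A M := Module.compHom M (Polynomial.C : A →+* A[X])
  have : IsScalarTower A A[X] M := ⟨fun a f m => by
    rw [Polynomial.smul_eq_C_mul, mul_smul]; rfl⟩
  refine projectiveDimensionLE_succ_of_exact (polyKoszulMap M) (polyActionMap M) ?_ ?_ ?_ n
    (projectiveDimensionLE_tensor n M (h M)) (projectiveDimensionLE_tensor n M (h M))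
  · exact Function.LeftInverse.injective polyHomotopy_polyKoszulMap
  · refine LinearMap.exact_of_comp_of_mem_range ?_ fun t ht => ⟨polyHomotopy M t, ?_⟩
    · refine LinearMap.restrictScalars_injective A (tensor_ext_X fun k m => ?_)
      simp [polyKoszulMap_tmul, polyActionMap_tmul, smul_smul, ← pow_succ, ← pow_succ']
    · rw [polyKoszulMap_polyHomotopy, ht]
      simp
  · exact fun m => ⟨1 ⊗ₜ m, by simp [polyActionMap_tmul]⟩

end polynomial

lemma projectiveDimensionLE_of_ringEquiv {A B : Type u} [CommRing A] [CommRing B] (e : A ≃+* B)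
    {n : ℕ} (h : ∀ (M : Type u) [AddCommGroup M] [Module A M],
      HasProjectiveDimensionLE (ModuleCat.of A M) n) (M : Type u) [AddCommGroup M]
    [Module B M] : HasProjectiveDimensionLE (ModuleCat.of B M) n := by
  let _ : Module A M := Module.compHom M e.toRingHom
  have := RingHomInvPair.of_ringEquiv e
  have := RingHomInvPair.of_ringEquiv e.symm
  let e' : ModuleCat.of A M ≃ₛₗ[RingHomClass.toRingHom e] ModuleCat.of B M :=
    { AddEquiv.refl M with map_smul' := fun r i => rfl }
  have := h M
  exact ModuleCat.hasProjectiveDimensionLE_of_semiLinearEquiv e e' n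

lemma projectiveDimensionLE_mvPolynomial (F : Type u) [Field F] (n : ℕ) (M : Type u)
    [AddCommGroup M] [Module (MvPolynomial (Fin n) F) M] :
    HasProjectiveDimensionLE (ModuleCat.of (MvPolynomial (Fin n) F) M) n := by
  induction n generalizing M with
  | zero =>
    refine projectiveDimensionLE_of_ringEquiv (isEmptyRingEquiv F (Fin 0)).symm (fun M _ _ => ?_) M
    rw [projectiveDimensionLE_zero_iff]
    infer_instance
  | succ n ih =>
    exact projectiveDimensionLE_of_ringEquiv (finSuccEquiv F n).symm.toRingEquiv
      (fun M _ _ => projectiveDimensionLE_polynomial (fun N _ _ => ih N) M) M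

lemma injectiveDimensionLE_mvPolynomial (F : Type u) [Field F] (n : ℕ)
    (M : ModuleCat.{u} (MvPolynomial (Fin n) F)) : HasInjectiveDimensionLE M n :=
  hasInjectiveDimensionLT_of_enoughProjectives M (n + 1) fun Y =>
    have := projectiveDimensionLE_mvPolynomial F n Y
    HasProjectiveDimensionLT.subsingleton Y (n + 1) (n + 1) le_rfl M

/-- The coextension of scalars of an `A`-module `M` along `A → B`. -/
def Coextension (A B M : Type*) [CommRing A] [CommRing B] [Algebra A B] [AddCommGroup M]
    [Module A M] : Type _ := B →ₗ[A] M

namespace Coextension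

variable {A B : Type*} [CommRing A] [CommRing B] [Algebra A B] {M N : Type*}
  [AddCommGroup M] [Module A M] [AddCommGroup N] [Module A N]

instance : AddCommGroup (Coextension A B M) := inferInstanceAs (AddCommGroup (B →ₗ[A] M))

instance : FunLike (Coextension A B M) B M := inferInstanceAs (FunLike (B →ₗ[A] M) B M)

/-- The underlying linear map of an element of a coextension. -/
def toLinearMap (f : Coextension A B M) : B →ₗ[A] M := f

instance : SMul B (Coextension A B M) :=
  ⟨fun b f => f.toLinearMap.comp (LinearMap.mul A B b)⟩

@[simp] lemma smul_apply (b c : B) (f : Coextension A B M) : (b • f) c = f (b * c) := rfl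

lemma map_add' (f : Coextension A B M) (b c : B) : f (b + c) = f b + f c :=
  f.toLinearMap.map_add b c

lemma map_smul' (f : Coextension A B M) (a : A) (c : B) : f (a • c) = a • f c :=
  f.toLinearMap.map_smul a c

@[simp] lemma add_apply (c : B) (f g : Coextension A B M) : (f + g) c = f c + g c := rfl

@[simp] lemma zero_apply (c : B) : (0 : Coextension A B M) c = 0 := rfl

@[ext] lemma ext {f g : Coextension A B M} (h : ∀ b, f b = g b) : f = g := LinearMap.ext h

instance : Module B (Coextension A B M) where
  one_smul f := by ext; simp
  mul_smul a b f := by ext c; simp [mul_left_comm, mul_assoc]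
  smul_zero a := by ext; simp
  smul_add a f g := by ext; simp
  add_smul a b f := by ext; simp [add_mul, map_add']
  zero_smul f := by ext c; rw [smul_apply, zero_mul]; exact f.toLinearMap.map_zero

/-- Functoriality of coextension of scalars. -/
def map (g : M →ₗ[A] N) : Coextension A B M →ₗ[B] Coextension A B N where
  toFun f := g.comp f.toLinearMap
  map_add' f f' := by ext c; exact g.map_add _ _
  map_smul' b f := rfl

@[simp] lemma map_apply (g : M →ₗ[A] N) (f : Coextension A B M) (b : B) :
    map g f b = g (f b) := rfl

lemma map_injective {g : M →ₗ[A] N} (hg : Function.Injective g) :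
    Function.Injective (map (B := B) g) :=
  fun _ _ h => ext fun b => hg (DFunLike.congr_fun h b)

lemma map_exact {L : Type*} [AddCommGroup L] [Module A L] {f : M →ₗ[A] N} {g : N →ₗ[A] L}
    (hf : Function.Injective f) (hfg : Function.Exact f g) :
    Function.Exact (map (B := B) f) (map (B := B) g) := by
  intro h
  constructor
  · intro hh
    have h1 : ∀ b, ∃ m, f m = h b := fun b => (hfg (h b)).1 (DFunLike.congr_fun hh b)
    choose k hk using h1
    let k' : B →ₗ[A] M :=
      { toFun := k
        map_add' := fun b c => hf (by simp only [hk, map_add, map_add'])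
        map_smul' := fun b c => hf (by simp only [hk, map_smul, map_smul', RingHom.id_apply]) }
    exact ⟨k', ext hk⟩
  · rintro ⟨k, rfl⟩
    ext b
    exact hfg.apply_apply_eq_zero (k b)

lemma injective {A B : Type u} [CommRing A] [CommRing B] [Algebra A B] (E : Type u)
    [AddCommGroup E] [Module A E] [hE : Module.Injective A E] :
    Module.Injective B (Coextension A B E) := by
  refine ⟨fun X Y _ _ _ _ f hf g => ?_⟩
  let _ : Module A X := Module.compHom X (algebraMap A B)
  let _ : Module A Y := Module.compHom Y (algebraMap A B)
  let f' : X →ₗ[A] Y := { f with map_smul' := fun a x => f.map_smul (algebraMap A B a) x }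
  let g' : X →ₗ[A] E :=
    { toFun := fun x => g x 1
      map_add' := fun x y => by rw [map_add]; rfl
      map_smul' := fun a x => by
        change g (algebraMap A B a • x) 1 = _
        rw [map_smul, smul_apply, RingHom.id_apply, ← map_smul', mul_one, Algebra.smul_def, mul_one] }
  obtain ⟨h, hh⟩ := hE.out f' hf g'
  let H (y : Y) : B →ₗ[A] E :=
    { toFun := fun b => h (b • y)
      map_add' := fun b c => by rw [add_smul, map_add]
      map_smul' := fun a b => by
        rw [RingHom.id_apply, ← h.map_smul, Algebra.smul_def, mul_smul]; rfl }
  refine ⟨{ toFun := H, map_add' := fun x y => ?_, map_smul' := fun b x => ?_ }, fun x => ?_⟩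
  · ext c
    exact (congrArg h (smul_add c x y)).trans (h.map_add _ _)
  · ext c
    change h (c • b • x) = h ((b * c) • x)
    rw [smul_smul, mul_comm]
  · ext b
    change h (b • f x) = g x b
    rw [← map_smul]
    refine (hh (b • x)).trans ?_
    change g (b • x) 1 = g x b
    rw [map_smul, smul_apply, mul_one]

/-- Coextension of scalars does not increase the injective dimension on a class `Q` of modules on
which it is exact. -/
lemma injectiveDimensionLE {A B : Type u} [CommRing A] [CommRing B] [Algebra A B]
    (Q : ∀ (M : Type u) [AddCommGroup M] [Module A M], Prop)
    (hQ : ∀ (E : Type u) [AddCommGroup E] [Module A E] [Module.Injective A E]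
      (M : Submodule A E), Q M →
      Q (E ⧸ M) ∧ Function.Surjective (map (B := B) M.mkQ))
    (hQe : ∀ (M N : Type u) [AddCommGroup M] [Module A M] [AddCommGroup N] [Module A N]
      (_ : M ≃ₗ[A] N), Q M → Q N)
    (n : ℕ) (M : Type u) [AddCommGroup M] [Module A M] (hM : Q M)
    (h : HasInjectiveDimensionLE (ModuleCat.of A M) n) :
    HasInjectiveDimensionLE (ModuleCat.of B (Coextension A B M)) n := by
  induction n generalizing M with
  | zero =>
    rw [injectiveDimensionLE_zero_iff] at h ⊢
    exact injective M
  | succ n ih =>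
    obtain ⟨E, _, _, _, f, hf⟩ := exists_injective_embedding (R := A) M
    have ex : Function.Exact f (LinearMap.range f).mkQ := LinearMap.exact_map_mkQ_range f
    have hs := Submodule.mkQ_surjective (LinearMap.range f)
    obtain ⟨h1, h2⟩ := hQ E (LinearMap.range f)
      (hQe _ _ (LinearEquiv.ofInjective f hf) hM)
    have := injective (A := A) (B := B) E
    exact (injectiveDimensionLE_succ_iff (map f) (map (LinearMap.range f).mkQ)
      (map_injective hf) (map_exact hf ex) h2 n).2
      (ih _ h1 ((injectiveDimensionLE_succ_iff f _ hf ex hs n).1 h))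

end Coextension

lemma injectiveDimensionLE_of_projective {P R : Type u} [CommRing P] [CommRing R] [Algebra P R]
    [Module.Projective P R] (φ : R →ₗ[P] P)
    (hφ : ∀ ψ : R →ₗ[P] P, ∃! f : R, ∀ r, ψ r = φ (f * r)) (n : ℕ)
    (h : HasInjectiveDimensionLE (ModuleCat.of P P) n) :
    HasInjectiveDimensionLE (ModuleCat.of R R) n := by
  have h1 : HasInjectiveDimensionLE (ModuleCat.of R (Coextension P R P)) n := by
    refine Coextension.injectiveDimensionLE (fun _ _ _ => True) ?_ (fun _ _ _ _ _ _ _ _ => trivial)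
      n P trivial h
    intro E _ _ _ M _
    refine ⟨trivial, fun g => ?_⟩
    obtain ⟨k, hk⟩ := Module.projective_lifting_property M.mkQ g.toLinearMap M.mkQ_surjective
    exact ⟨k, hk⟩
  let e : R →ₗ[R] Coextension P R P :=
    LinearMap.toSpanSingleton R (Coextension P R P) φ
  have he : Function.Bijective e := by
    constructor
    · intro a b hab
      obtain ⟨c, -, hc⟩ := hφ (e a).toLinearMap
      rw [hc a fun r => rfl, hc b fun r => by rw [hab]; rfl]
    · intro g
      obtain ⟨c, hc, -⟩ := hφ g.toLinearMap
      exact ⟨c, Coextension.ext fun r => (hc r).symm⟩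
  exact (ModuleCat.hasInjectiveDimensionLE_iff_of_linearEquiv (LinearEquiv.ofBijective e he) n).2 h1

lemma injectiveDimensionLE_of_exact_left {R : Type u} [CommRing R] {K L M : Type u}
    [AddCommGroup K] [AddCommGroup L] [AddCommGroup M] [Module R K] [Module R L] [Module R M]
    (f : K →ₗ[R] L) (g : L →ₗ[R] M) (hf : Function.Injective f)
    (hfg : Function.Exact f g) (hg : Function.Surjective g) (n : ℕ)
    (hK : HasInjectiveDimensionLE (ModuleCat.of R K) 0)
    (hL : HasInjectiveDimensionLE (ModuleCat.of R L) n) :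
    HasInjectiveDimensionLE (ModuleCat.of R M) n := by
  obtain ⟨S, hS, h1, h2, h3⟩ := exists_shortExact f g hf hfg hg
  rw [← h3]
  rw [← h1] at hK
  rw [← h2] at hL
  exact hS.hasInjectiveDimensionLT_X₃ (n + 1) hL (hasInjectiveDimensionLT_of_ge _ 1 _ (by omega))

lemma Module.Injective.exists_smul_eq {A E : Type u} [CommRing A] [AddCommGroup E] [Module A E]
    [hE : Module.Injective A E] {x : A} (hx : ∀ a, x * a = 0 → a = 0) (m : E) :
    ∃ k : E, x • k = m := by
  let f : A →ₗ[A] A := LinearMap.mul A A x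
  have hf : Function.Injective f := (injective_iff_map_eq_zero f).2 hx
  obtain ⟨h, hh⟩ := hE.out f hf (LinearMap.toSpanSingleton A E m)
  refine ⟨h 1, ?_⟩
  rw [← map_smul]
  simpa [f] using hh 1

/-- A map from `A ⧸ (x)` to a module is the same as an `x`-torsion element. -/
lemma Coextension.exists_quotient {A M : Type*} [CommRing A] [AddCommGroup M] [Module A M] {x : A}
    {m : M} (hm : x • m = 0) :
    ∃ f : Coextension A (A ⧸ Ideal.span {x}) M, f 1 = m := by
  refine ⟨(Ideal.span {x}).liftQ (LinearMap.toSpanSingleton A M m) ?_, ?_⟩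
  · rw [Ideal.span, Submodule.span_le]
    simpa using hm
  · exact (Submodule.liftQ_apply _ _ (1 : A)).trans (one_smul A m)

lemma Coextension.quotient_ext {A M : Type*} [CommRing A] [AddCommGroup M] [Module A M]
    {I : Ideal A} {f g : Coextension A (A ⧸ I) M} (h : f 1 = g 1) : f = g := by
  ext b
  obtain ⟨a, rfl⟩ := Ideal.Quotient.mk_surjective b
  have : Ideal.Quotient.mk I a = a • (1 : A ⧸ I) := by rw [Algebra.smul_def, mul_one]; rfl
  rw [this, map_smul', map_smul', h]

lemma Coextension.smul_apply_one_eq_zero {A M : Type*} [CommRing A] [AddCommGroup M] [Module A M]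
    {x : A} (f : Coextension A (A ⧸ Ideal.span {x}) M) : x • f 1 = 0 := by
  rw [← map_smul', Algebra.smul_def, mul_one, Ideal.Quotient.algebraMap_eq,
    Ideal.Quotient.eq_zero_iff_mem.2 (Ideal.mem_span_singleton_self x)]
  exact f.toLinearMap.map_zero

lemma injectiveDimensionLE_quotient_span_singleton {A : Type u} [CommRing A] {x : A}
    (hx : ∀ a, x * a = 0 → a = 0)
    (h : ∃ n, HasInjectiveDimensionLE (ModuleCat.of A A) n) :
    ∃ n, HasInjectiveDimensionLE
      (ModuleCat.of (A ⧸ Ideal.span {x}) (A ⧸ Ideal.span {x})) n := by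
  obtain ⟨n, hn⟩ := h
  set B := A ⧸ Ideal.span {x}
  have key := Coextension.injectiveDimensionLE (A := A) (B := B)
    (fun M _ _ => ∀ m : M, ∃ k, x • k = m)
    (fun E _ _ _ M hM => by
      have hE := Module.Injective.exists_smul_eq (E := E) hx
      refine ⟨fun m => ?_, fun f => ?_⟩
      · obtain ⟨e, rfl⟩ := M.mkQ_surjective m
        obtain ⟨k, rfl⟩ := hE e
        exact ⟨M.mkQ k, (map_smul M.mkQ x k).symm⟩
      · obtain ⟨e, he⟩ := M.mkQ_surjective (f 1)
        have h1 : x • e ∈ M := by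
          have := f.smul_apply_one_eq_zero
          rwa [← he, ← map_smul, Submodule.mkQ_apply, Submodule.Quotient.mk_eq_zero] at this
        obtain ⟨⟨k, hk⟩, hk'⟩ := hM ⟨x • e, h1⟩
        have hk2 : x • k = x • e := congrArg Subtype.val hk'
        obtain ⟨g, hg⟩ := Coextension.exists_quotient (x := x) (m := e - k)
          (by rw [smul_sub, hk2, sub_self])
        refine ⟨g, Coextension.quotient_ext ?_⟩
        rw [Coextension.map_apply, hg, map_sub, he]
        simpa using hk)
    (fun M N _ _ _ _ e hM m => by
      obtain ⟨k, hk⟩ := hM (e.symm m)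
      exact ⟨e k, by rw [← map_smul, hk, e.apply_symm_apply]⟩)
  obtain ⟨E, _, _, _, f, hf⟩ := exists_injective_embedding (R := A) A
  have ex : Function.Exact f (LinearMap.range f).mkQ := LinearMap.exact_map_mkQ_range f
  have hs := Submodule.mkQ_surjective (LinearMap.range f)
  have hE := Module.Injective.exists_smul_eq (E := E) hx
  have hC : HasInjectiveDimensionLE (ModuleCat.of A (E ⧸ LinearMap.range f)) n := by
    cases n with
    | zero =>
      exact (injectiveDimensionLE_succ_iff f _ hf ex hs 0).1
        (hasInjectiveDimensionLT_of_ge _ 1 _ (by omega))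
    | succ n =>
      have := (injectiveDimensionLE_succ_iff f _ hf ex hs n).1 hn
      exact hasInjectiveDimensionLT_of_ge _ (n + 1) _ (by omega)
  have h1 := key n (E ⧸ LinearMap.range f) (fun m => by
    obtain ⟨e, rfl⟩ := hs m
    obtain ⟨k, rfl⟩ := hE e
    exact ⟨_, (map_smul _ x k).symm⟩) hC
  have h2 : HasInjectiveDimensionLE (ModuleCat.of B (Coextension A B E)) 0 :=
    (injectiveDimensionLE_zero_iff).2 (Coextension.injective E)
  have h3 (g : Coextension A B (E ⧸ LinearMap.range f)) :
      ∃ b : B, ∀ e a, (LinearMap.range f).mkQ e = g 1 → x • e = f a → Ideal.Quotient.mk _ a = b := by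
    obtain ⟨e, he⟩ := hs (g 1)
    obtain ⟨a, ha⟩ := (ex (x • e)).1 (by
      rw [map_smul, he]; exact g.smul_apply_one_eq_zero)
    refine ⟨Ideal.Quotient.mk _ a, fun e' a' he' ha' => ?_⟩
    obtain ⟨c, hc⟩ := (ex (e' - e)).1 (by rw [map_sub, he, he', sub_self])
    refine Ideal.Quotient.eq.2 (Ideal.mem_span_singleton'.2 ⟨c, hf ?_⟩)
    rw [map_sub, ← ha', ha, ← smul_sub, ← hc, ← map_smul, smul_eq_mul, mul_comm]
  have h4 (g : Coextension A B (E ⧸ LinearMap.range f)) :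
      ∃ e a, (LinearMap.range f).mkQ e = g 1 ∧ x • e = f a := by
    obtain ⟨e, he⟩ := hs (g 1)
    obtain ⟨a, ha⟩ := (ex (x • e)).1 (by
      rw [map_smul, he]; exact g.smul_apply_one_eq_zero)
    exact ⟨e, a, he, ha.symm⟩
  choose δ hδ using h3
  let δ' : Coextension A B (E ⧸ LinearMap.range f) →ₗ[B] B :=
    { toFun := δ
      map_add' := fun g g' => by
        obtain ⟨e, a, h, h'⟩ := h4 g
        obtain ⟨e', a', k, k'⟩ := h4 g'
        rw [← hδ g e a h h', ← hδ g' e' a' k k',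
          ← hδ (g + g') (e + e') (a + a') (by rw [map_add, h, k]; rfl)
            (by rw [smul_add, h', k', map_add]), map_add]
      map_smul' := fun b g => by
        obtain ⟨r, rfl⟩ := Ideal.Quotient.mk_surjective b
        obtain ⟨e, a, h, h'⟩ := h4 g
        rw [← hδ g e a h h', ← hδ _ (r • e) (r • a) ?_ (by rw [smul_comm, h', map_smul]),
          smul_eq_mul, map_mul]
        · rfl
        · rw [map_smul, h, ← Coextension.map_smul', Coextension.smul_apply, Algebra.smul_def]
          rfl }
  refine ⟨n, injectiveDimensionLE_of_exact_left
    (Coextension.map (B := B) (LinearMap.range f).mkQ) δ' ?_ ?_ ?_ n h2 h1⟩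
  · refine (injective_iff_map_eq_zero _).2 fun g hg => Coextension.quotient_ext ?_
    obtain ⟨a, ha⟩ := (ex (g 1)).1 (DFunLike.congr_fun hg 1)
    have := g.smul_apply_one_eq_zero
    rw [← ha, ← map_smul] at this
    rw [← ha, hx a (hf (this.trans (map_zero f).symm)), map_zero]
    rfl
  · intro g
    obtain ⟨e, a, h, h'⟩ := h4 g
    have h5 : δ' g = Ideal.Quotient.mk _ a := (hδ g e a h h').symm
    rw [h5, Ideal.Quotient.eq_zero_iff_mem, Ideal.mem_span_singleton']
    constructor
    · rintro ⟨b, rfl⟩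
      obtain ⟨k, hk⟩ := Coextension.exists_quotient (x := x) (m := e - f b)
        (by rw [smul_sub, h', ← map_smul, smul_eq_mul, mul_comm, sub_self])
      refine ⟨k, Coextension.quotient_ext ?_⟩
      rw [Coextension.map_apply, hk, map_sub, h, ex.apply_apply_eq_zero, sub_zero]
    · rintro ⟨k, rfl⟩
      obtain ⟨c, hc⟩ := (ex (e - k 1)).1 (by rw [map_sub, h, Coextension.map_apply, sub_self])
      refine ⟨c, hf ?_⟩
      rw [← h', mul_comm, ← smul_eq_mul, map_smul, hc, smul_sub, k.smul_apply_one_eq_zero, sub_zero]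
  · intro b
    obtain ⟨a, rfl⟩ := Ideal.Quotient.mk_surjective b
    obtain ⟨e, he⟩ := hE (f a)
    obtain ⟨g, hg⟩ := Coextension.exists_quotient (x := x) (m := (LinearMap.range f).mkQ e)
      (by rw [← map_smul, he, ex.apply_apply_eq_zero])
    exact ⟨g, (hδ g e a hg.symm he).symm⟩

section
variable {R : Type u} [CommRing R] {K L M : Type u} [AddCommGroup K] [AddCommGroup L]
  [AddCommGroup M] [Module R K] [Module R L] [Module R M] (Y : ModuleCat.{u} R)

lemma subsingleton_ext_of_exact (f : K →ₗ[R] L) (g : L →ₗ[R] M)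
    (hf : Function.Injective f) (hfg : Function.Exact f g) (hg : Function.Surjective g) (n : ℕ)
    (hK : Subsingleton (Abelian.Ext (ModuleCat.of R K) Y n))
    (hM : Subsingleton (Abelian.Ext (ModuleCat.of R M) Y n)) :
    Subsingleton (Abelian.Ext (ModuleCat.of R L) Y n) := by
  obtain ⟨S, hS, h1, h2, h3⟩ := exists_shortExact f g hf hfg hg
  rw [← h1] at hK
  rw [← h3] at hM
  rw [← h2]
  refine subsingleton_of_forall_eq 0 fun x => ?_
  obtain ⟨z, rfl⟩ := Abelian.Ext.contravariant_sequence_exact₂ hS Y x (Subsingleton.elim _ _)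
  rw [Subsingleton.elim z 0, Abelian.Ext.comp_zero]

lemma subsingleton_ext_of_exact_left (f : K →ₗ[R] L) (g : L →ₗ[R] M)
    (hf : Function.Injective f) (hfg : Function.Exact f g) (hg : Function.Surjective g) (n : ℕ)
    (hL : Subsingleton (Abelian.Ext (ModuleCat.of R L) Y n))
    (hM : Subsingleton (Abelian.Ext (ModuleCat.of R M) Y (n + 1))) :
    Subsingleton (Abelian.Ext (ModuleCat.of R K) Y n) := by
  obtain ⟨S, hS, h1, h2, h3⟩ := exists_shortExact f g hf hfg hg
  rw [← h2] at hL
  rw [← h3] at hM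
  rw [← h1]
  refine subsingleton_of_forall_eq 0 fun x => ?_
  obtain ⟨z, rfl⟩ := Abelian.Ext.contravariant_sequence_exact₁ hS Y x (add_comm 1 n)
    (Subsingleton.elim _ _)
  rw [Subsingleton.elim z 0, Abelian.Ext.comp_zero]

end

section
variable {B : Type u} [CommRing B] {𝔪 : Ideal B}

lemma exists_embedding_free [h𝔪 : 𝔪.IsMaximal] {s : B} (hs : s ≠ 0)
    (hs' : ∀ a ∈ 𝔪, a * s = 0) (V : Type u) [AddCommGroup V] [Module B V]
    (hV : ∀ a ∈ 𝔪, ∀ v : V, a • v = 0) :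
    ∃ (ι : Type u) (f : V →ₗ[B] ι →₀ B), Function.Injective f := by
  have hT : Module.IsTorsionBySet B V 𝔪 := fun v a => hV a a.2 v
  let _ : Module (B ⧸ 𝔪) V := hT.module
  have : IsScalarTower B (B ⧸ 𝔪) V := hT.isScalarTower
  let _ : Field (B ⧸ 𝔪) := Ideal.Quotient.field 𝔪
  let b := Module.Basis.ofVectorSpace (B ⧸ 𝔪) V
  let g : (B ⧸ 𝔪) →ₗ[B] B := Submodule.liftQ 𝔪 (LinearMap.toSpanSingleton B B s) hs'
  have hg : Function.Injective g := by
    rw [← LinearMap.ker_eq_bot]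
    refine Submodule.ker_liftQ_eq_bot _ _ _ ?_
    by_contra h
    have h1 : 𝔪 < LinearMap.ker (LinearMap.toSpanSingleton B B s) := lt_of_le_not_ge hs' h
    have h2 := h𝔪.out.2 _ h1
    have h3 : (1 : B) ∈ LinearMap.ker (LinearMap.toSpanSingleton B B s) := h2 ▸ Submodule.mem_top
    exact hs (by simpa using h3)
  refine ⟨_, (Finsupp.mapRange.linearMap g).comp (b.repr.toLinearMap.restrictScalars B), ?_⟩
  exact (Finsupp.mapRange_injective g (map_zero g) hg).comp b.repr.injective

lemma injective_self_of_injectiveDimensionLE [h𝔪 : 𝔪.IsMaximal] {N : ℕ} (hN : 𝔪 ^ N = ⊥) {s : B}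
    (hs : s ≠ 0) (hs' : ∀ a ∈ 𝔪, a * s = 0) (n : ℕ)
    (h : HasInjectiveDimensionLE (ModuleCat.of B B) n) : Module.Injective B B := by
  induction n with
  | zero => exact injectiveDimensionLE_zero_iff.1 h
  | succ n ih =>
    refine ih (hasInjectiveDimensionLT_of_enoughProjectives _ (n + 1) ?_)
    have key (V : Type u) [AddCommGroup V] [Module B V] (hV : ∀ a ∈ 𝔪, ∀ v : V, a • v = 0) :
        Subsingleton (Abelian.Ext (ModuleCat.of B V) (ModuleCat.of B B) (n + 1)) := by
      obtain ⟨ι, f, hf⟩ := exists_embedding_free hs hs' V hV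
      refine subsingleton_ext_of_exact_left _ f (LinearMap.range f).mkQ hf
        (LinearMap.exact_map_mkQ_range f) (Submodule.mkQ_surjective _) _ ?_ ?_
      · have := projectiveDimensionLE_zero_iff.2 (inferInstance : Module.Projective B (ι →₀ B))
        exact HasProjectiveDimensionLT.subsingleton _ 1 _ (by omega) _
      · exact HasInjectiveDimensionLT.subsingleton _ (n + 2) _ (by omega) _
    have key2 (r : ℕ) : ∀ (V : Type u) [AddCommGroup V] [Module B V],
        (∀ a ∈ 𝔪 ^ r, ∀ v : V, a • v = 0) →
        Subsingleton (Abelian.Ext (ModuleCat.of B V) (ModuleCat.of B B) (n + 1)) := by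
      induction r with
      | zero => exact fun V _ _ hV => key V fun a _ => hV a (by simp)
      | succ r ihr =>
        intro V _ _ hV
        refine subsingleton_ext_of_exact _ (𝔪 • (⊤ : Submodule B V)).subtype
          (𝔪 • (⊤ : Submodule B V)).mkQ (Submodule.subtype_injective _)
          (LinearMap.exact_subtype_mkQ _) (Submodule.mkQ_surjective _) _ (ihr _ ?_) (key _ ?_)
        · rintro a ha ⟨v, hv⟩
          ext
          change a • v = 0
          refine Submodule.smul_induction_on hv (fun c hc w _ => ?_) fun x y hx hy => ?_
          · rw [smul_smul]
            exact hV _ (by rw [pow_succ]; exact Ideal.mul_mem_mul ha hc) w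
          · rw [smul_add, hx, hy, add_zero]
        · intro a ha v
          obtain ⟨w, rfl⟩ := Submodule.mkQ_surjective _ v
          rw [← map_smul, Submodule.mkQ_apply, Submodule.Quotient.mk_eq_zero]
          exact Submodule.smul_mem_smul ha trivial
    intro Y
    refine key2 N Y fun a ha v => ?_
    rw [hN] at ha
    rw [(Submodule.mem_bot B).1 ha, zero_smul]

lemma exists_eq_mul_of_socle [h𝔪 : 𝔪.IsMaximal] {N : ℕ} (hN : 𝔪 ^ N = ⊥)
    (h : ∃ n, HasInjectiveDimensionLE (ModuleCat.of B B) n) {s t : B} (hs : s ≠ 0)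
    (hs' : ∀ a ∈ 𝔪, a * s = 0) (ht : ∀ a ∈ 𝔪, a * t = 0) : ∃ r, t = r * s := by
  obtain ⟨n, hn⟩ := h
  have inj := injective_self_of_injectiveDimensionLE hN hs hs' n hn
  have ker (r : B) (hr : r * s = 0) : r ∈ 𝔪 := by
    by_contra hr'
    obtain ⟨b, c, hc, hb⟩ := h𝔪.exists_inv hr'
    apply hs
    rw [← one_mul s, ← hb, add_mul, hs' c hc, mul_assoc, hr, mul_zero, add_zero]
  let f : (B ⧸ 𝔪) →ₗ[B] B := Submodule.liftQ 𝔪 (LinearMap.toSpanSingleton B B s) hs'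
  let g : (B ⧸ 𝔪) →ₗ[B] B := Submodule.liftQ 𝔪 (LinearMap.toSpanSingleton B B t) ht
  have hf : Function.Injective f := by
    rw [← LinearMap.ker_eq_bot]
    exact Submodule.ker_liftQ_eq_bot _ _ _ ker
  obtain ⟨k, hk⟩ := inj.out f hf g
  have h1 : k s = t := (congrArg k (one_smul B s).symm).trans
    ((hk (Submodule.Quotient.mk 1)).trans (one_smul B t))
  exact ⟨k 1, by rw [← h1, mul_comm, ← smul_eq_mul, ← map_smul, smul_eq_mul, mul_one]⟩

end

lemma injectiveDimensionLE_of_ringEquiv {A B : Type u} [CommRing A] [CommRing B] (e : A ≃+* B)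
    {n : ℕ} (h : HasInjectiveDimensionLE (ModuleCat.of A A) n) :
    HasInjectiveDimensionLE (ModuleCat.of B B) n := by
  have := RingHomInvPair.of_ringEquiv e
  have := RingHomInvPair.of_ringEquiv e.symm
  let e' : ModuleCat.of A A ≃ₛₗ[RingHomClass.toRingHom e] ModuleCat.of B B :=
    { e with map_smul' := fun r i => e.map_mul r i }
  exact (ModuleCat.hasInjectiveDimensionLE_iff_of_semiLinearEquiv e e' n).1 h

lemma injectiveDimensionLE_quotient_sup {A : Type u} [CommRing A] {I : Ideal A} {x : A}
    (hx : ∀ a, x * a ∈ I → a ∈ I)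
    (h : ∃ n, HasInjectiveDimensionLE (ModuleCat.of (A ⧸ I) (A ⧸ I)) n) :
    ∃ n, HasInjectiveDimensionLE
      (ModuleCat.of (A ⧸ I ⊔ Ideal.span {x}) (A ⧸ I ⊔ Ideal.span {x})) n := by
  obtain ⟨n, hn⟩ := injectiveDimensionLE_quotient_span_singleton (A := A ⧸ I)
    (x := Ideal.Quotient.mk I x) (fun a ha => by
      obtain ⟨a, rfl⟩ := Ideal.Quotient.mk_surjective a
      rw [← map_mul, Ideal.Quotient.eq_zero_iff_mem] at ha
      exact Ideal.Quotient.eq_zero_iff_mem.2 (hx a ha)) h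
  have e1 : Ideal.span {Ideal.Quotient.mk I x} = (Ideal.span {x}).map (Ideal.Quotient.mk I) := by
    rw [Ideal.map_span, Set.image_singleton]
  exact ⟨n, injectiveDimensionLE_of_ringEquiv
    ((Ideal.quotEquivOfEq e1).trans (DoubleQuot.quotQuotEquivQuotSup I (Ideal.span {x}))) hn⟩

section
variable {R : Type u} [CommRing R] {𝔪 : Ideal R} [h𝔪 : 𝔪.IsMaximal]

lemma injectiveDimensionLE_localization_quotient_sup {I : Ideal R} {x : R}
    (hx : ∀ a, x * a ∈ I → a ∈ I)
    (h : ∃ n, HasInjectiveDimensionLE (ModuleCat.of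
      (Localization.AtPrime 𝔪 ⧸ I.map (algebraMap R (Localization.AtPrime 𝔪)))
      (Localization.AtPrime 𝔪 ⧸ I.map (algebraMap R (Localization.AtPrime 𝔪)))) n) :
    ∃ n, HasInjectiveDimensionLE (ModuleCat.of
      (Localization.AtPrime 𝔪 ⧸ (I ⊔ Ideal.span {x}).map (algebraMap R (Localization.AtPrime 𝔪)))
      (Localization.AtPrime 𝔪 ⧸
        (I ⊔ Ideal.span {x}).map (algebraMap R (Localization.AtPrime 𝔪)))) n := by
  rw [Ideal.map_sup, Ideal.map_span, Set.image_singleton]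
  refine injectiveDimensionLE_quotient_sup (fun a ha => ?_) h
  obtain ⟨r, s, rfl⟩ := IsLocalization.exists_mk'_eq 𝔪.primeCompl a
  rw [← IsLocalization.mk'_one (M := 𝔪.primeCompl) (Localization.AtPrime 𝔪) x,
    ← IsLocalization.mk'_mul, IsLocalization.mk'_mem_map_algebraMap_iff] at ha
  obtain ⟨u, hu, hu'⟩ := ha
  rw [IsLocalization.mk'_mem_map_algebraMap_iff]
  exact ⟨u, hu, hx _ (by rwa [mul_left_comm] at hu')⟩

lemma exists_mul_sub_mem_of_socle {I : Ideal R} {N : ℕ} (hN : 𝔪 ^ N ≤ I) (hI : I ≤ 𝔪)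
    (h : ∃ n, HasInjectiveDimensionLE (ModuleCat.of
      (Localization.AtPrime 𝔪 ⧸ I.map (algebraMap R (Localization.AtPrime 𝔪)))
      (Localization.AtPrime 𝔪 ⧸ I.map (algebraMap R (Localization.AtPrime 𝔪)))) n)
    {s t : R} (hs : s ∉ I) (hs' : ∀ a ∈ 𝔪, a * s ∈ I) (ht : ∀ a ∈ 𝔪, a * t ∈ I) :
    ∃ r, t - r * s ∈ I := by
  set L := Localization.AtPrime 𝔪
  set J := I.map (algebraMap R L)
  have cancel (w a : R) (hw : w ∈ 𝔪.primeCompl) (hwa : w * a ∈ I) (ha : ∀ c ∈ 𝔪, c * a ∈ I) :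
      a ∈ I := by
    obtain ⟨b, c, hc, hb⟩ := h𝔪.exists_inv hw
    rw [← one_mul a, ← hb, add_mul, mul_assoc]
    exact I.add_mem (I.mul_mem_left b hwa) (ha c hc)
  let φ : R →+* L ⧸ J := (Ideal.Quotient.mk J).comp (algebraMap R L)
  have hφ (a : R) (ha : a ∈ I) : φ a = 0 :=
    Ideal.Quotient.eq_zero_iff_mem.2 (Ideal.mem_map_of_mem _ ha)
  have hmax : (𝔪.map φ).IsMaximal := by
    rw [← Ideal.map_map, Localization.AtPrime.map_eq_maximalIdeal]
    refine (Ideal.map_eq_top_or_isMaximal_of_surjective _ Ideal.Quotient.mk_surjective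
      (IsLocalRing.maximalIdeal.isMaximal L)).resolve_left fun h => ?_
    have h1 : (IsLocalRing.maximalIdeal L) ⊔ J = ⊤ := by
      have := congrArg (Ideal.comap (Ideal.Quotient.mk J)) h
      rwa [Ideal.comap_map_of_surjective _ Ideal.Quotient.mk_surjective, ← RingHom.ker_eq_comap_bot,
        Ideal.mk_ker, Ideal.comap_top] at this
    have h2 : J ≤ IsLocalRing.maximalIdeal L := by
      rw [← Localization.AtPrime.map_eq_maximalIdeal]
      exact Ideal.map_mono hI
    rw [sup_eq_left.2 h2] at h1
    exact (IsLocalRing.maximalIdeal.isMaximal L).ne_top h1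
  have hpow : (𝔪.map φ) ^ N = ⊥ := by
    rw [← Ideal.map_pow, eq_bot_iff, Ideal.map_le_iff_le_comap]
    exact fun a ha => (Ideal.mem_bot).2 (hφ a (hN ha))
  have hsoc (s : R) (hs : ∀ a ∈ 𝔪, a * s ∈ I) : ∀ a ∈ 𝔪.map φ, a * φ s = 0 := by
    intro a ha
    refine Submodule.span_induction ?_ (zero_mul _) (fun x y _ _ hx hy => ?_)
      (fun c x _ hx => ?_) ha
    · rintro _ ⟨b, hb, rfl⟩
      rw [← map_mul, hφ _ (hs b hb)]
    · rw [add_mul, hx, hy, add_zero]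
    · rw [smul_eq_mul, mul_assoc, hx, mul_zero]
  have hs0 : φ s ≠ 0 := by
    intro h0
    have h1 : algebraMap R L s ∈ J := Ideal.Quotient.eq_zero_iff_mem.1 h0
    rw [IsLocalization.algebraMap_mem_map_algebraMap_iff 𝔪.primeCompl] at h1
    obtain ⟨w, hw, hw'⟩ := h1
    exact hs (cancel w s hw hw' hs')
  obtain ⟨r, hr⟩ := exists_eq_mul_of_socle hpow h hs0 (hsoc s hs') (hsoc t ht)
  obtain ⟨r, rfl⟩ := Ideal.Quotient.mk_surjective r
  obtain ⟨r, u, rfl⟩ := IsLocalization.exists_mk'_eq 𝔪.primeCompl r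
  have h1 : algebraMap R L (u * t - r * s) ∈ J := by
    have h2 : algebraMap R L t - IsLocalization.mk' L r u * algebraMap R L s ∈ J :=
      Ideal.Quotient.eq.1 hr
    have h3 := J.mul_mem_left (algebraMap R L u) h2
    rwa [mul_sub, ← mul_assoc, IsLocalization.mk'_spec', ← map_mul, ← map_mul, ← map_sub] at h3
  rw [IsLocalization.algebraMap_mem_map_algebraMap_iff 𝔪.primeCompl] at h1
  obtain ⟨v, hv, hv'⟩ := h1
  obtain ⟨b, c, hc, hb⟩ := h𝔪.exists_inv (𝔪.primeCompl.mul_mem hv u.2)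
  refine ⟨b * v * r, ?_⟩
  have h2 : t - b * v * r * s = b * (v * (u * t - r * s)) + c * t := by
    linear_combination (-t) * hb
  rw [h2]
  exact I.add_mem (I.mul_mem_left b hv') (ht c hc)

end

lemma isGorensteinRing_of_injectiveDimensionLE {R : Type u} [CommRing R] [IsNoetherianRing R]
    {n : ℕ} (h : HasInjectiveDimensionLE (ModuleCat.of R R) n) : IsGorensteinRing R := by
  refine ⟨inferInstance, fun P _ => (hasFiniteInjectiveDimension_iff _).2 ⟨n, ?_⟩⟩
  have h1 := ModuleCat.localizedModule_hasInjectiveDimensionLE n P.primeCompl (ModuleCat.of R R)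
  have e := LinearEquiv.extendScalarsOfIsLocalization P.primeCompl (Localization.AtPrime P)
    (@IsLocalizedModule.linearEquiv R _ P.primeCompl _ _ _ _ _ _ _ _ _
      ((ModuleCat.of R R).localizedModuleMkLinearMap P.primeCompl)
      (Algebra.linearMap R (Localization.AtPrime P))
      (ModuleCat.localizedModule_isLocalizedModule (ModuleCat.of R R) P.primeCompl) _)
  exact (ModuleCat.hasInjectiveDimensionLE_iff_of_linearEquiv
    (M := (ModuleCat.of R R).localizedModule P.primeCompl)
    (N := ModuleCat.of (Localization.AtPrime P) (Localization.AtPrime P)) e n).1 h1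

lemma IsGorensteinRing.of_ringEquiv {A B : Type u} [CommRing A] [CommRing B] (e : A ≃+* B)
    (h : IsGorensteinRing A) : IsGorensteinRing B := by
  have := h.1
  refine ⟨isNoetherianRing_of_ringEquiv A e, fun P _ => (hasFiniteInjectiveDimension_iff _).2 ?_⟩
  obtain ⟨n, hn⟩ := (hasFiniteInjectiveDimension_iff _).1 (h.2 (P.comap e))
  exact ⟨n, injectiveDimensionLE_of_ringEquiv (Localization.localRingEquiv _ P e rfl) hn⟩

section coefficients
variable {F σ : Type*} [Field F]

/-- The algebra of polynomials whose monomials have exponents in `M`. -/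
def monomialSubalgebra (F : Type*) {σ : Type*} [Field F] (M : AddSubmonoid (σ →₀ ℕ)) :
    Subalgebra F (MvPolynomial σ F) where
  carrier := {f | ∀ α ∈ f.support, α ∈ M}
  mul_mem' := fun {f g} hf hg α hα => by
    classical
    obtain ⟨β, hβ, γ, hγ, rfl⟩ := Finset.mem_add.1 (support_mul f g hα)
    exact M.add_mem (hf β hβ) (hg γ hγ)
  add_mem' := fun {f g} hf hg α hα => by
    classical
    exact (Finset.mem_union.1 (support_add hα)).elim (hf α) (hg α)
  algebraMap_mem' := fun r α hα => by
    classical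
    rw [algebraMap_eq, mem_support_iff, coeff_C] at hα
    rw [← (by simpa using hα : 0 = α ∧ _).1]
    exact M.zero_mem

lemma mem_monomialSubalgebra {M : AddSubmonoid (σ →₀ ℕ)} {f : MvPolynomial σ F} :
    f ∈ monomialSubalgebra F M ↔ ∀ α ∈ f.support, α ∈ M := Iff.rfl

lemma monomial_mem_monomialSubalgebra {M : AddSubmonoid (σ →₀ ℕ)} {α : σ →₀ ℕ} (hα : α ∈ M)
    (c : F) : monomial α c ∈ monomialSubalgebra F M := fun β hβ => by
  classical
  rwa [Finset.mem_singleton.1 (support_monomial_subset hβ)]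

open scoped Classical in
/-- The polynomial collecting the coefficients of the exponents congruent to `α` modulo `m`. -/
def residuePart (m : ℕ) (α : σ →₀ ℕ) : MvPolynomial σ F →ₗ[F] MvPolynomial σ F :=
  (basisMonomials σ F).constr F fun β =>
    if β.mapRange (· % m) (Nat.zero_mod m) = α then
      monomial (β.mapRange (· / m) (Nat.zero_div m)) 1 else 0

open scoped Classical in
lemma residuePart_monomial (m : ℕ) (α β : σ →₀ ℕ) :
    residuePart m α (monomial β (1 : F)) = if β.mapRange (· % m) (Nat.zero_mod m) = α then
      monomial (β.mapRange (· / m) (Nat.zero_div m)) 1 else 0 := by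
  have := (basisMonomials σ F).constr_basis F (fun β : σ →₀ ℕ =>
    if β.mapRange (· % m) (Nat.zero_mod m) = α then
      monomial (β.mapRange (· / m) (Nat.zero_div m)) (1 : F) else 0) β
  rwa [coe_basisMonomials] at this

lemma linearMap_ext_monomial {N : Type*} [AddCommGroup N] [Module F N]
    {f g : MvPolynomial σ F →ₗ[F] N} (h : ∀ β, f (monomial β 1) = g (monomial β 1)) : f = g :=
  (basisMonomials σ F).ext fun β => by rw [coe_basisMonomials]; exact h β

lemma residuePart_expand_mul {m : ℕ} (hm : 0 < m) (α : σ →₀ ℕ) (g f : MvPolynomial σ F) :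
    residuePart m α (expand m g * f) = g * residuePart m α f := by
  have h1 (δ : σ →₀ ℕ) : (residuePart m α).comp (LinearMap.mulLeft F (monomial (m • δ) (1 : F))) =
      (LinearMap.mulLeft F (monomial δ 1)).comp (residuePart m α) := by
    refine linearMap_ext_monomial fun β => ?_
    have h2 : (m • δ + β).mapRange (· % m) (Nat.zero_mod m) =
        β.mapRange (· % m) (Nat.zero_mod m) := by ext i; simp
    have h3 : (m • δ + β).mapRange (· / m) (Nat.zero_div m) =
        δ + β.mapRange (· / m) (Nat.zero_div m) := by
      ext i
      simp [Nat.mul_add_div hm]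
    simp only [LinearMap.comp_apply, LinearMap.mulLeft_apply, monomial_mul, one_mul,
      residuePart_monomial, h2, h3]
    by_cases h : β.mapRange (· % m) (Nat.zero_mod m) = α
    · rw [if_pos (h2.trans h), if_pos h, monomial_mul, one_mul]
    · rw [if_neg fun h' => h (h2.symm.trans h'), if_neg h, mul_zero]
  have h2 : (residuePart m α).comp ((LinearMap.mulRight F f).comp (expand m).toLinearMap) =
      LinearMap.mulRight F (residuePart m α f) := by
    refine linearMap_ext_monomial fun δ => ?_
    have := LinearMap.congr_fun (h1 δ) f
    simpa [expand_monomial] using this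
  exact LinearMap.congr_fun h2 g

/-- The exponent all of whose entries are `m - 1`. -/
def topExponent (σ : Type*) [Finite σ] (m : ℕ) : σ →₀ ℕ :=
  Finsupp.equivFunOnFinite.symm fun _ => m - 1

variable [Finite σ]

@[simp] lemma topExponent_apply (m : ℕ) (i : σ) : topExponent σ m i = m - 1 := rfl

lemma le_topExponent_iff {m : ℕ} (hm : 0 < m) {α : σ →₀ ℕ} :
    α ≤ topExponent σ m ↔ ∀ i, α i < m := by
  refine forall_congr' fun i => ?_
  rw [topExponent_apply]
  omega

lemma mapRange_mod_eq_iff {m : ℕ} (hm : 0 < m) {α β : σ →₀ ℕ} (hα : α ≤ topExponent σ m) :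
    β.mapRange (· % m) (Nat.zero_mod m) = α ↔ ∃ γ, β = m • γ + α := by
  rw [le_topExponent_iff hm] at hα
  constructor
  · rintro rfl
    exact ⟨β.mapRange (· / m) (Nat.zero_div m), by ext i; simp [Nat.div_add_mod]⟩
  · rintro ⟨γ, rfl⟩
    ext i
    simp [Nat.mod_eq_of_lt (hα i)]

lemma residuePart_monomial_add {m : ℕ} (hm : 0 < m) {α : σ →₀ ℕ} (hα : α ≤ topExponent σ m)
    (γ : σ →₀ ℕ) : residuePart m α (monomial (m • γ + α) (1 : F)) = monomial γ 1 := by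
  rw [residuePart_monomial, if_pos ((mapRange_mod_eq_iff hm hα).2 ⟨γ, rfl⟩)]
  refine congrArg (fun d => monomial d 1) (Finsupp.ext fun i => ?_)
  simp [Nat.mul_add_div hm, Nat.div_eq_of_lt ((le_topExponent_iff hm).1 hα i)]

lemma residuePart_monomial_mul {m : ℕ} (hm : 0 < m) {α : σ →₀ ℕ} (hα : α ≤ topExponent σ m)
    (f : MvPolynomial σ F) :
    residuePart m (topExponent σ m) (monomial (topExponent σ m - α) 1 * f) =
      residuePart m α f := by
  suffices (residuePart m (topExponent σ m)).comp
      (LinearMap.mulLeft F (monomial (topExponent σ m - α) (1 : F))) = residuePart m α from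
    LinearMap.congr_fun this f
  refine linearMap_ext_monomial fun β => ?_
  rw [LinearMap.comp_apply, LinearMap.mulLeft_apply, monomial_mul, one_mul]
  have key (γ : σ →₀ ℕ) : topExponent σ m - α + β = m • γ + topExponent σ m ↔ β = m • γ + α := by
    nth_rw 2 [← tsub_add_cancel_of_le hα]
    rw [add_left_comm, add_right_inj]
  by_cases h : ∃ γ, β = m • γ + α
  · obtain ⟨γ, hγ⟩ := h
    rw [(key γ).2 hγ, hγ, residuePart_monomial_add hm hα, residuePart_monomial_add hm le_rfl]
  · rw [residuePart_monomial, residuePart_monomial, if_neg, if_neg]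
    · rwa [mapRange_mod_eq_iff hm hα]
    · rw [mapRange_mod_eq_iff hm le_rfl]
      rintro ⟨γ, hγ⟩
      exact h ⟨γ, (key γ).1 hγ⟩

lemma sum_expand_residuePart [DecidableEq σ] {m : ℕ} (hm : 0 < m) (f : MvPolynomial σ F) :
    ∑ α ∈ Finset.Iic (topExponent σ m), expand m (residuePart m α f) * monomial α 1 = f := by
  suffices ∑ α ∈ Finset.Iic (topExponent σ m), (LinearMap.mulRight F (monomial α (1 : F))).comp
      ((expand m).toLinearMap.comp (residuePart m α)) = LinearMap.id by
    simpa using LinearMap.congr_fun this f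
  refine linearMap_ext_monomial fun β => ?_
  have hβ : β.mapRange (· % m) (Nat.zero_mod m) ∈ Finset.Iic (topExponent σ m) := by
    rw [Finset.mem_Iic, le_topExponent_iff hm]
    exact fun i => by simpa using Nat.mod_lt _ hm
  rw [LinearMap.sum_apply, Finset.sum_eq_single_of_mem _ hβ]
  · simp only [LinearMap.comp_apply, residuePart_monomial, if_true, AlgHom.toLinearMap_apply,
      expand_monomial, LinearMap.mulRight_apply, monomial_mul, one_mul, LinearMap.id_apply]
    refine congrArg (fun d => monomial d 1) (Finsupp.ext fun i => ?_)
    simp [Nat.div_add_mod]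
  · intro α _ hα
    simp [residuePart_monomial, hα.symm]

lemma residuePart_eq_zero {M : AddSubmonoid (σ →₀ ℕ)} {m : ℕ} (hm : 0 < m)
    (hM : ∀ α β, α ∈ M → α + β ∈ M → β ∈ M) (hMm : ∀ β, m • β ∈ M)
    {α : σ →₀ ℕ} (hα : α ≤ topExponent σ m) (hαM : α ∉ M) {f : MvPolynomial σ F}
    (hf : f ∈ monomialSubalgebra F M) : residuePart m α f = 0 := by
  rw [f.as_sum, map_sum]
  refine Finset.sum_eq_zero fun β hβ => ?_
  rw [← mul_one (coeff β f), ← smul_eq_mul, ← smul_monomial, map_smul, residuePart_monomial,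
    if_neg, smul_zero]
  rw [mapRange_mod_eq_iff hm hα]
  rintro ⟨γ, rfl⟩
  exact hαM (hM _ _ (hMm γ) (hf _ hβ))

end coefficients

lemma expand_mem_monomialSubalgebra {F σ : Type*} [Field F] {M : AddSubmonoid (σ →₀ ℕ)} {m : ℕ}
    (hMm : ∀ β, m • β ∈ M) (f : MvPolynomial σ F) : expand m f ∈ monomialSubalgebra F M := by
  rw [f.as_sum, map_sum]
  refine Subalgebra.sum_mem _ fun β _ => ?_
  rw [expand_monomial]
  exact monomial_mem_monomialSubalgebra (hMm β) _

theorem isGorensteinRing_monomialSubalgebra {F : Type u} [Field F] {d : ℕ}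
    {M : AddSubmonoid (Fin d →₀ ℕ)} {m : ℕ} (hm : 0 < m)
    (hM : ∀ α β, α ∈ M → α + β ∈ M → β ∈ M) (hMm : ∀ β, m • β ∈ M)
    (htop : topExponent (Fin d) m ∈ M) : IsGorensteinRing (monomialSubalgebra F M) := by
  classical
  set R := monomialSubalgebra F M
  let P := MvPolynomial (Fin d) F
  let μ := topExponent (Fin d) m
  let _ : Algebra P R :=
    ((expand m).codRestrict R (expand_mem_monomialSubalgebra hMm)).toRingHom.toAlgebra
  have smul_def (g : P) (f : R) : ((g • f : R) : P) = expand m g * f := by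
    rw [Algebra.smul_def]; rfl
  let κ (α : Fin d →₀ ℕ) : R →ₗ[P] P :=
    { toFun := fun f => residuePart m α (f : P)
      map_add' := fun f g => map_add _ _ _
      map_smul' := fun g f => by
        rw [smul_def, residuePart_expand_mul hm, RingHom.id_apply, smul_eq_mul] }
  let x (α : M) : R := ⟨monomial α.1 1, monomial_mem_monomialSubalgebra α.2 1⟩
  let S := {α : M // α.1 ≤ μ}
  have : Finite S := by
    refine Set.Finite.to_subtype ?_
    refine Set.Finite.of_finite_image (f := Subtype.val) ?_ Subtype.val_injective.injOn
    exact (Finset.finite_toSet (Finset.Iic μ)).subset <| by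
      rintro _ ⟨a, ha, rfl⟩
      exact Finset.mem_coe.2 (Finset.mem_Iic.2 ha)
  let _ := Fintype.ofFinite S
  have expansion (f : R) : ∑ α : S, κ α.1 f • x α.1 = f := by
    apply Subtype.ext
    rw [AddSubmonoidClass.coe_finsetSum]
    refine Eq.trans ?_ (sum_expand_residuePart hm (f : P))
    refine Finset.sum_of_injOn (fun α : S => α.1.1) (fun a _ b _ h => Subtype.ext (Subtype.ext h))
      (fun a _ => by simpa using a.2) (fun α hα hα' => ?_) (fun a _ => smul_def _ _)
    rw [Finset.mem_Iic] at hα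
    rw [residuePart_eq_zero hm hM hMm hα ?_ f.2, map_zero, zero_mul]
    exact fun h => hα' ⟨⟨⟨α, h⟩, hα⟩, by simp, rfl⟩
  let i : R →ₗ[P] (S → P) := LinearMap.pi fun α => κ α.1
  let s : (S → P) →ₗ[P] R := Fintype.linearCombination P fun α => x α.1
  have hsi : s.comp i = LinearMap.id := LinearMap.ext expansion
  have : Module.Projective P R := Module.Projective.of_split i s hsi
  have : Module.Finite P R := Module.Finite.of_surjective s fun f => ⟨i f, LinearMap.congr_fun hsi f⟩
  have : IsNoetherianRing R := IsNoetherianRing.of_finite P R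
  let y (α : S) : R := x ⟨μ - α.1, hM _ _ α.1.2 (by rw [add_tsub_cancel_of_le α.2]; exact htop)⟩
  have hy (α : S) (f : R) : κ μ (y α * f) = κ α.1 f := residuePart_monomial_mul hm α.2 (f : P)
  have hex (ψ : R →ₗ[P] P) (r : R) : ψ r = κ μ ((∑ α : S, ψ (x α.1) • y α) * r) := by
    simp only [Finset.sum_mul, smul_mul_assoc, map_sum, map_smul, hy]
    conv_lhs => rw [← expansion r]
    simp only [map_sum, map_smul, smul_eq_mul, mul_comm]
  refine isGorensteinRing_of_injectiveDimensionLE (n := d)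
    (injectiveDimensionLE_of_projective (κ μ) (fun ψ => ⟨_, hex ψ, fun f hf => ?_⟩) d
      (injectiveDimensionLE_mvPolynomial F d _))
  rw [← sub_eq_zero, ← expansion (f - _)]
  refine Finset.sum_eq_zero fun α _ => ?_
  rw [← hy, mul_comm, sub_mul, map_sub, ← hex, ← hf, sub_self, zero_smul]

lemma injectiveDimensionLE_localization_quotient {R : Type u} {σ : Type*} [CommRing R] [DecidableEq σ]
    {𝔪 : Ideal R} [𝔪.IsMaximal] {I : Finset σ → Ideal R} {x : σ → R} (h0 : I ∅ = ⊥)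
    (hins : ∀ i s, I (insert i s) = I s ⊔ Ideal.span {x i})
    (hx : ∀ i s, i ∉ s → ∀ a, x i * a ∈ I s → a ∈ I s) (h : IsGorensteinRing R) (s : Finset σ) :
    ∃ n, HasInjectiveDimensionLE (ModuleCat.of
      (Localization.AtPrime 𝔪 ⧸ (I s).map (algebraMap R (Localization.AtPrime 𝔪)))
      (Localization.AtPrime 𝔪 ⧸ (I s).map (algebraMap R (Localization.AtPrime 𝔪)))) n := by
  induction s using Finset.induction_on with
  | empty =>
    rw [h0, Ideal.map_bot]
    obtain ⟨n, hn⟩ := (hasFiniteInjectiveDimension_iff _).1 (h.2 𝔪)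
    exact ⟨n, injectiveDimensionLE_of_ringEquiv (RingEquiv.quotientBot _).symm hn⟩
  | insert i s hi ih =>
    rw [hins]
    exact injectiveDimensionLE_localization_quotient_sup (hx i s hi) ih

lemma exists_mul_sub_mem_of_isGorensteinRing {R : Type u} {σ : Type*} [CommRing R] [DecidableEq σ]
    {𝔪 : Ideal R} [𝔪.IsMaximal] {I : Finset σ → Ideal R} {x : σ → R} (h0 : I ∅ = ⊥)
    (hins : ∀ i s, I (insert i s) = I s ⊔ Ideal.span {x i})
    (hx : ∀ i s, i ∉ s → ∀ a, x i * a ∈ I s → a ∈ I s) (h : IsGorensteinRing R) {s : Finset σ}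
    {N : ℕ} (hN : 𝔪 ^ N ≤ I s) (hI : I s ≤ 𝔪) (a b : R) (ha : a ∉ I s)
    (ha' : ∀ c ∈ 𝔪, c * a ∈ I s) (hb : ∀ c ∈ 𝔪, c * b ∈ I s) : ∃ r, b - r * a ∈ I s :=
  exists_mul_sub_mem_of_socle hN hI (injectiveDimensionLE_localization_quotient h0 hins hx h s)
    ha ha' hb

section exponents
variable {F : Type u} {σ : Type} [Field F] {M : AddSubmonoid (σ →₀ ℕ)}

/-- The ideal of polynomials whose exponents all have an entry in `s` that is at least `m`. -/
def exponentIdeal (F : Type u) [Field F] (M : AddSubmonoid (σ →₀ ℕ)) (m : ℕ) (s : Finset σ) :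
    Ideal (monomialSubalgebra F M) where
  carrier := {f | ∀ α ∈ (f : MvPolynomial σ F).support, ∃ i ∈ s, m ≤ α i}
  add_mem' := fun {f g} hf hg α hα => by
    classical
    exact (Finset.mem_union.1 (support_add hα)).elim (hf α) (hg α)
  zero_mem' := fun α hα => by simp at hα
  smul_mem' := fun g f hf α hα => by
    classical
    obtain ⟨β, hβ, γ, hγ, rfl⟩ := Finset.mem_add.1 (support_mul _ _ hα)
    obtain ⟨i, hi, h⟩ := hf γ hγ
    exact ⟨i, hi, h.trans (Nat.le_add_left _ _)⟩

lemma mem_exponentIdeal {m : ℕ} {s : Finset σ} {f : monomialSubalgebra F M} :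
    f ∈ exponentIdeal F M m s ↔ ∀ α ∈ (f : MvPolynomial σ F).support, ∃ i ∈ s, m ≤ α i := Iff.rfl

/-- The monomial with coefficient `c` and exponent `α ∈ M`, in the monomial subalgebra. -/
def memMonomial (α : M) (c : F) : monomialSubalgebra F M :=
  ⟨monomial α.1 c, monomial_mem_monomialSubalgebra α.2 c⟩

@[simp] lemma coe_memMonomial (α : M) (c : F) :
    (memMonomial α c : MvPolynomial σ F) = monomial α.1 c := rfl

lemma exponentIdeal_empty (m : ℕ) : exponentIdeal F M m ∅ = ⊥ := by
  refine eq_bot_iff.2 fun f hf => Subtype.ext ?_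
  rw [mem_exponentIdeal] at hf
  exact support_eq_empty.1 (Finset.eq_empty_of_forall_notMem fun α hα => by simpa using hf α hα)

lemma exponentIdeal_insert [DecidableEq σ] {m : ℕ} (hM : ∀ α β, α ∈ M → α + β ∈ M → β ∈ M)
    (hMm : ∀ β, m • β ∈ M) (i : σ) (s : Finset σ) :
    exponentIdeal F M m (insert i s) = exponentIdeal F M m s ⊔
      Ideal.span {memMonomial ⟨m • Finsupp.single i 1, hMm _⟩ 1} := by
  apply le_antisymm
  · intro f hf
    have h : f = ∑ α ∈ (f : MvPolynomial σ F).support.attach,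
        memMonomial ⟨α.1, f.2 α.1 α.2⟩ (coeff α.1 (f : MvPolynomial σ F)) := by
      apply Subtype.ext
      rw [AddSubmonoidClass.coe_finsetSum]
      conv_lhs => rw [(f : MvPolynomial σ F).as_sum, ← Finset.sum_attach]
      rfl
    rw [h]
    refine Ideal.sum_mem _ fun α _ => ?_
    obtain ⟨j, hj, hm⟩ := hf α.1 α.2
    rcases Finset.mem_insert.1 hj with rfl | hj
    · have hle : m • Finsupp.single j 1 ≤ α.1 := by
        rw [Finsupp.smul_single, smul_eq_mul, mul_one]
        exact Finsupp.single_le_iff.2 hm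
      refine Ideal.mem_sup_right (Ideal.mem_span_singleton'.2
        ⟨memMonomial ⟨α.1 - m • Finsupp.single j 1, hM _ _ (hMm (Finsupp.single j 1))
          (by rw [add_tsub_cancel_of_le hle]; exact f.2 α.1 α.2)⟩ (coeff α.1 f.1),
          Subtype.ext ?_⟩)
      simp [monomial_mul, tsub_add_cancel_of_le hle, -Finsupp.smul_single]
    · refine Ideal.mem_sup_left fun β hβ => ⟨j, hj, ?_⟩
      rwa [Finset.mem_singleton.1 (support_monomial_subset hβ)]
  · refine sup_le (fun f hf α hα => ?_) ((Ideal.span_singleton_le_iff_mem _).2 fun α hα => ?_)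
    · obtain ⟨j, hj, h⟩ := hf α hα
      exact ⟨j, Finset.mem_insert_of_mem hj, h⟩
    · refine ⟨i, Finset.mem_insert_self _ _, ?_⟩
      rw [Finset.mem_singleton.1 (support_monomial_subset hα)]
      simp

lemma mem_exponentIdeal_of_mul_mem {m : ℕ} (hMm : ∀ β, m • β ∈ M) {i : σ} {s : Finset σ}
    (hi : i ∉ s) {f : monomialSubalgebra F M}
    (h : memMonomial ⟨m • Finsupp.single i 1, hMm _⟩ 1 * f ∈ exponentIdeal F M m s) :
    f ∈ exponentIdeal F M m s := by
  intro α hα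
  obtain ⟨j, hj, h'⟩ := h (m • Finsupp.single i 1 + α) (by
    rw [mem_support_iff] at hα ⊢
    simpa [coeff_monomial_mul, -Finsupp.smul_single] using hα)
  refine ⟨j, hj, ?_⟩
  have : i ≠ j := fun h => hi (h ▸ hj)
  simpa [Finsupp.single_eq_of_ne' this] using h'

/-- The ideal of polynomials in the monomial subalgebra without constant term. -/
def augmentationIdeal (F : Type u) [Field F] (M : AddSubmonoid (σ →₀ ℕ)) :
    Ideal (monomialSubalgebra F M) :=
  RingHom.ker (constantCoeff.comp (monomialSubalgebra F M).val.toRingHom)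

instance isMaximal_augmentationIdeal : (augmentationIdeal F M).IsMaximal :=
  RingHom.ker_isMaximal_of_surjective _ fun c => ⟨algebraMap F _ c, by
    rw [RingHom.comp_apply]
    exact constantCoeff_C σ c⟩

lemma mem_augmentationIdeal {f : monomialSubalgebra F M} :
    f ∈ augmentationIdeal F M ↔ coeff 0 (f : MvPolynomial σ F) = 0 := Iff.rfl

lemma le_degree_of_mem_augmentationIdeal_pow {k : ℕ} {f : monomialSubalgebra F M}
    (hf : f ∈ augmentationIdeal F M ^ k) {α : σ →₀ ℕ} (hα : α ∈ (f : MvPolynomial σ F).support) :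
    k ≤ α.degree := by
  classical
  induction k generalizing f α with
  | zero => exact Nat.zero_le _
  | succ k ih =>
    rw [pow_succ] at hf
    induction hf using Submodule.mul_induction_on' generalizing α with
    | mem_mul_mem g hg h hh =>
      obtain ⟨β, hβ, γ, hγ, rfl⟩ := Finset.mem_add.1 (support_mul _ _ hα)
      rw [map_add]
      refine Nat.add_le_add (ih hg hβ) (Nat.one_le_iff_ne_zero.2 fun h0 => ?_)
      rw [Finsupp.degree_eq_zero_iff] at h0
      rw [h0, mem_support_iff] at hγ
      exact hγ (mem_augmentationIdeal.1 hh)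
    | add g hg h hh ihg ihh => exact (Finset.mem_union.1 (support_add hα)).elim ihg ihh

lemma augmentationIdeal_pow_le [Fintype σ] (m : ℕ) :
    augmentationIdeal F M ^ (Fintype.card σ * m + 1) ≤ exponentIdeal F M m Finset.univ := by
  intro f hf α hα
  have h := le_degree_of_mem_augmentationIdeal_pow hf hα
  by_contra! h'
  rw [Finsupp.degree_eq_sum] at h
  have := Finset.sum_le_card_nsmul Finset.univ α m fun i _ => (h' i (Finset.mem_univ i)).le
  rw [smul_eq_mul, Finset.card_univ] at this
  exact (h.trans this).not_gt (Nat.lt_succ_self _)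

lemma exponentIdeal_le {m : ℕ} (hm : 0 < m) (s : Finset σ) :
    exponentIdeal F M m s ≤ augmentationIdeal F M := by
  intro f hf
  rw [mem_augmentationIdeal]
  by_contra h
  obtain ⟨i, -, hi⟩ := hf 0 (mem_support_iff.2 h)
  exact hm.ne' (Nat.le_zero.1 hi)

theorem topExponent_mem_of_isGorensteinRing [Fintype σ] {m : ℕ} (hm : 0 < m)
    (hM : ∀ α β, α ∈ M → α + β ∈ M → β ∈ M) (hMm : ∀ β, m • β ∈ M)
    (h : IsGorensteinRing (monomialSubalgebra F M))
    (hmax : ∀ i, ∃ α ∈ M, α ≤ topExponent σ m ∧ α i = m - 1) : topExponent σ m ∈ M := by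
  classical
  have hfin : ({α | α ∈ M ∧ α ≤ topExponent σ m} : Set (σ →₀ ℕ)).Finite :=
    (Finset.finite_toSet (Finset.Iic (topExponent σ m))).subset fun α hα =>
      Finset.mem_coe.2 (Finset.mem_Iic.2 hα.2)
  have hn := exists_mul_sub_mem_of_isGorensteinRing (𝔪 := augmentationIdeal F M)
    (exponentIdeal_empty m) (exponentIdeal_insert hM hMm)
    (fun i s hi f hf => mem_exponentIdeal_of_mul_mem hMm hi hf) h
    (augmentationIdeal_pow_le m) (exponentIdeal_le hm _)
  have hsocle {μ : σ →₀ ℕ} (hμ : Maximal (fun α => α ∈ M ∧ α ≤ topExponent σ m) μ)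
      (a : monomialSubalgebra F M) (ha : a ∈ augmentationIdeal F M) :
      a * memMonomial ⟨μ, hμ.prop.1⟩ 1 ∈ exponentIdeal F M m Finset.univ := by
    intro α hα
    obtain ⟨β, hβ, γ, hγ, rfl⟩ := Finset.mem_add.1 (support_mul _ _ hα)
    obtain rfl := Finset.mem_singleton.1 (support_monomial_subset hγ)
    by_contra! hlt
    have h1 := hμ.le_of_ge ⟨M.add_mem (a.2 β hβ) hμ.prop.1,
      (le_topExponent_iff hm).2 fun i => hlt i (Finset.mem_univ i)⟩ le_add_self
    have h2 : β = 0 := by simpa using h1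
    rw [h2, mem_support_iff] at hβ
    exact hβ (mem_augmentationIdeal.1 ha)
  have hnot {μ : σ →₀ ℕ} (hμ : μ ≤ topExponent σ m) : ¬ ∃ i ∈ Finset.univ, m ≤ μ i := by
    rintro ⟨i, -, hi⟩
    exact ((le_topExponent_iff hm).1 hμ i).not_ge hi
  have hunique {μ ν : σ →₀ ℕ} (hμ : Maximal (fun α => α ∈ M ∧ α ≤ topExponent σ m) μ)
      (hν : Maximal (fun α => α ∈ M ∧ α ≤ topExponent σ m) ν) : μ = ν := by
    obtain ⟨r, hr⟩ := hn (memMonomial ⟨μ, hμ.prop.1⟩ 1) (memMonomial ⟨ν, hν.prop.1⟩ 1)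
      (fun hs => hnot hμ.prop.2 (hs μ (by simp))) (hsocle hμ) (hsocle hν)
    by_contra hne
    refine hnot hν.prop.2 (hr ν ?_)
    rw [mem_support_iff]
    have : ¬ μ ≤ ν := fun hle => hne (hμ.eq_of_le hν.prop hle)
    simp [coeff_mul_monomial', this]
  have hle (i : σ) : ∃ μ, Maximal (fun α => α ∈ M ∧ α ≤ topExponent σ m) μ ∧ μ i = m - 1 := by
    obtain ⟨α, hα, hα', hi⟩ := hmax i
    obtain ⟨μ, hle, hμ⟩ := hfin.exists_le_maximal ⟨hα, hα'⟩
    refine ⟨μ, hμ, le_antisymm (hμ.prop.2 i) ?_⟩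
    rw [← hi]
    exact hle i
  obtain ⟨μ, -, hμ⟩ := hfin.exists_le_maximal (a := 0) ⟨M.zero_mem, zero_le⟩
  have : μ = topExponent σ m := by
    ext i
    obtain ⟨ν, hν, hi⟩ := hle i
    rw [hunique hμ hν, hi, topExponent_apply]
  exact this ▸ hμ.prop.1

end exponents

lemma prod_add_add {A B : Type*} [CommRing A] [IsDomain A] [AddCommGroup B] [Fintype B]
    (φ : B →+ A) (hφ : Function.Injective φ) (z w : A) :
    ∏ b, (z + w + φ b) = ∏ b, (z + φ b) + ∏ b, (w + φ b) := by
  classical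
  have hmonic (x : A) : (∏ b, (Polynomial.X + Polynomial.C (x + φ b))).Monic :=
    Polynomial.monic_prod_of_monic _ _ fun b _ => Polynomial.monic_X_add_C _
  have hdeg (x : A) : (∏ b, (Polynomial.X + Polynomial.C (x + φ b))).degree =
      ((Fintype.card B : ℕ) : WithBot ℕ) := by
    rw [Polynomial.degree_prod]
    simp only [Polynomial.degree_X_add_C, Finset.sum_const, Finset.card_univ, nsmul_one]
  have h : ∏ b, (Polynomial.X + Polynomial.C (w + φ b)) =
      ∏ b, (Polynomial.X + Polynomial.C (0 + φ b)) + Polynomial.C (∏ b, (w + φ b)) := by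
    have hneg : Function.Injective fun b => -φ b := fun b b' h => hφ (neg_injective h)
    refine Polynomial.eq_of_degree_sub_lt_of_eval_finset_eq
      (Finset.univ.image fun b => -φ b) ?_ ?_
    · rw [Finset.card_image_of_injective _ hneg, Finset.card_univ, ← sub_sub]
      refine (Polynomial.degree_sub_le _ _).trans_lt (max_lt ?_ ?_)
      · rw [← hdeg w]
        exact Polynomial.degree_sub_lt_left ((hdeg w).trans (hdeg 0).symm) (hmonic w).ne_zero
          ((hmonic w).trans (hmonic 0).symm)
      · exact Polynomial.degree_C_le.trans_lt (by exact_mod_cast Fintype.card_pos)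
    · intro x hx
      obtain ⟨b, -, rfl⟩ := Finset.mem_image.1 hx
      rw [Polynomial.eval_add, Polynomial.eval_prod, Polynomial.eval_prod, Polynomial.eval_C]
      have h0 : ∏ b', Polynomial.eval (-φ b) (Polynomial.X + Polynomial.C (0 + φ b')) = 0 :=
        Finset.prod_eq_zero (Finset.mem_univ b) (by simp)
      rw [h0, zero_add]
      refine Fintype.prod_equiv (Equiv.subRight b) _ _ fun b' => ?_
      simp only [Polynomial.eval_add, Polynomial.eval_X, Polynomial.eval_C, Equiv.subRight_apply,
        map_sub]
      ring
  have := congrArg (Polynomial.eval z) h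
  simpa [Polynomial.eval_prod, add_assoc] using this

/-- Monomials on which the characters `g ↦ χ g i` cancel. -/
def weightMonoid {F ι σ : Type*} [Field F] [Fintype σ] (χ : ι → σ → F) :
    AddSubmonoid (σ →₀ ℕ) where
  carrier := {α | ∀ g, ∏ i, χ g i ^ α i = 1}
  zero_mem' := fun g => by simp
  add_mem' := fun {α β} hα hβ g => by simp [pow_add, Finset.prod_mul_distrib, hα g, hβ g]

section weights
variable {F : Type u} {ι : Type*} [Field F]

lemma mem_weightMonoid {σ : Type*} [Fintype σ] {χ : ι → σ → F} {α : σ →₀ ℕ} :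
    α ∈ weightMonoid χ ↔ ∀ g, ∏ i, χ g i ^ α i = 1 := Iff.rfl

lemma exists_mem_weightMonoid_le_topExponent {σ : Type*} [Fintype σ] {χ : ι → σ → F} {m : ℕ}
    (hm : 0 < m) (hχ : ∀ g i, χ g i ^ m = 1) {α : σ → ℕ} (hα : ∀ g, ∏ i, χ g i ^ α i = 1) (k : ℕ)
    {i : σ} (hi : α i = 1) (hk : k % m = m - 1) :
    ∃ β ∈ weightMonoid χ, β ≤ topExponent σ m ∧ β i = m - 1 := by
  refine ⟨Finsupp.equivFunOnFinite.symm fun j => α j * k % m, fun g => ?_,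
    (le_topExponent_iff hm).2 fun j => Nat.mod_lt _ hm, by simp [hi, hk]⟩
  simp only [Finsupp.equivFunOnFinite_symm_apply_apply]
  rw [← one_pow k, ← hα g, ← Finset.prod_pow]
  refine Finset.prod_congr rfl fun j _ => ?_
  rw [← pow_mul, ← pow_mod_orderOf, ← pow_mod_orderOf _ (α j * k),
    Nat.mod_mod_of_dvd _ (orderOf_dvd_of_pow_eq_one (hχ g j))]

theorem isGorensteinRing_weightMonoid_iff {c a d : ι → F} (h : ∀ g, c g * a g * d g = 1) {m q : ℕ}
    (hm : 0 < m) (hq : 0 < q) (hqm : q.Coprime m) (hc : ∀ g, c g ^ m = 1) (ha : ∀ g, a g ^ m = 1)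
    (hd : ∀ g, d g ^ m = 1) :
    IsGorensteinRing (monomialSubalgebra F (weightMonoid fun g => ![c g, a g ^ q, d g])) ↔
      ∀ g, a g ^ (q - 1) = 1 := by
  set χ : ι → Fin 3 → F := fun g => ![c g, a g ^ q, d g]
  have hχ (g i) : χ g i ^ m = 1 := by
    fin_cases i
    · exact hc g
    · exact (pow_right_comm _ _ _).trans (by rw [ha, one_pow])
    · exact hd g
  have hM (α β : Fin 3 →₀ ℕ) (hα : α ∈ weightMonoid χ) (hαβ : α + β ∈ weightMonoid χ) :
      β ∈ weightMonoid χ := fun g => by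
    simpa [pow_add, Finset.prod_mul_distrib, hα g] using hαβ g
  have hMm (β : Fin 3 →₀ ℕ) : m • β ∈ weightMonoid χ := fun g => by simp [pow_mul, hχ]
  have hmax (i : Fin 3) : ∃ α ∈ weightMonoid χ, α ≤ topExponent (Fin 3) m ∧ α i = m - 1 := by
    have hk : (m - 1) % m = m - 1 := Nat.mod_eq_of_lt (Nat.sub_lt hm one_pos)
    obtain ⟨r, -, hr⟩ := Nat.exists_mul_mod_eq_of_coprime 1 hqm hm.ne'
    have h1 (g) : ∏ i, χ g i ^ (![1, r, 1] : Fin 3 → ℕ) i = 1 := by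
      have : (a g ^ q) ^ r = a g := by
        have hr' : (q * r) % orderOf (a g) = 1 % orderOf (a g) :=
          Nat.ModEq.of_dvd (orderOf_dvd_of_pow_eq_one (ha g)) hr
        rw [← pow_mul, ← pow_mod_orderOf, hr', pow_mod_orderOf, pow_one]
      simp [Fin.prod_univ_three, χ, this, h]
    have h2 (g) : ∏ i, χ g i ^ (![q, 1, q] : Fin 3 → ℕ) i = 1 := by
      simp [Fin.prod_univ_three, χ, ← mul_pow, h]
    fin_cases i
    · exact exists_mem_weightMonoid_le_topExponent hm hχ h1 (m - 1) rfl hk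
    · exact exists_mem_weightMonoid_le_topExponent hm hχ h2 (m - 1) rfl hk
    · exact exists_mem_weightMonoid_le_topExponent hm hχ h1 (m - 1) rfl hk
  have htop : topExponent (Fin 3) m ∈ weightMonoid χ ↔ ∀ g, a g ^ (q - 1) = 1 := by
    refine forall_congr' fun g => ?_
    have hone : ∏ i, χ g i = a g ^ (q - 1) := by
      obtain ⟨q, rfl⟩ := Nat.exists_eq_add_of_le' hq
      simp only [Fin.prod_univ_three, χ, Matrix.cons_val]
      rw [Nat.add_sub_cancel]
      refine Eq.trans ?_ (mul_one _)
      rw [← h g]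
      ring
    simp only [topExponent_apply]
    rw [Finset.prod_pow, ← hone]
    have hpow : (∏ i, χ g i) ^ (m - 1) * ∏ i, χ g i = 1 := by
      rw [← pow_succ, Nat.sub_add_cancel hm, ← Finset.prod_pow]
      exact Finset.prod_eq_one fun i _ => hχ g i
    exact ⟨fun h => by rwa [h, one_mul] at hpow, fun h => by rw [h, one_pow]⟩
  rw [← htop]
  exact ⟨fun h => topExponent_mem_of_isGorensteinRing hm hM hMm h hmax,
    isGorensteinRing_monomialSubalgebra hm hM hMm⟩

end weights

section shears
variable {F : Type u} [Field F]

lemma polyAct_X {m : ℕ} (M : Matrix (Fin m) (Fin m) F) (i : Fin m) :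
    polyAct M (X i) = ∑ j, M i j • X j := aeval_X _ _

lemma polyAct_mul {m : ℕ} (M N : Matrix (Fin m) (Fin m) F) (f : MvPolynomial (Fin m) F) :
    polyAct (M * N) f = polyAct N (polyAct M f) := by
  suffices polyAct (M * N) = (polyAct N).comp (polyAct M) from congrArg (· f) this
  refine MvPolynomial.algHom_ext fun i => ?_
  simp only [AlgHom.comp_apply, polyAct_X, map_sum, map_smul, Matrix.mul_apply, Finset.sum_smul,
    Finset.smul_sum, smul_smul]
  exact Finset.sum_comm

variable (B : AddSubgroup F)

/-- The additive map `b ↦ b * X 2`. -/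
def mulX : B →+ MvPolynomial (Fin 3) F :=
  (AddMonoidHom.mulRight (X 2)).comp ((C : F →+* _).toAddMonoidHom.comp B.subtype)

lemma mulX_apply (b : B) : mulX B b = C (b : F) * X 2 := rfl

lemma mulX_injective : Function.Injective (mulX B) := fun _ _ h =>
  Subtype.ext (C_injective _ _ (mul_right_cancel₀ (X_ne_zero 2) h))

variable [Fintype B]

/-- The product of the translates of the second variable by the multiples `b • X 2` with
`b ∈ B`, plus a multiple of a power of the third variable. -/
def orbitForm (t : F) : MvPolynomial (Fin 3) F :=
  ∏ b : B, (X 1 + C (b : F) * X 2) + C t * X 2 ^ Fintype.card B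

/-- The evaluation of polynomials at `X 0`, `orbitForm B t` and `X 2`. -/
def orbitHom (t : F) : MvPolynomial (Fin 3) F →ₐ[F] MvPolynomial (Fin 3) F :=
  aeval ![X 0, orbitForm B t, X 2]

lemma orbitHom_injective (t : F) : Function.Injective (orbitHom B t) := by
  refine (injective_iff_map_eq_zero _).2 fun f hf => ?_
  refine map_injective _ (algebraMap F (AlgebraicClosure F)).injective ?_
  rw [map_zero]
  have : Infinite (AlgebraicClosure F) := IsAlgClosed.instInfinite
  refine MvPolynomial.funext fun u => ?_
  let h : Polynomial (AlgebraicClosure F) :=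
    ∏ b : B, (Polynomial.X + Polynomial.C (algebraMap F _ (b : F) * u 2)) +
      Polynomial.C (algebraMap F _ t * u 2 ^ Fintype.card B - u 1)
  obtain ⟨z, hz⟩ : ∃ z, h.IsRoot z := by
    refine IsAlgClosed.exists_root h ?_
    have hdeg : (∏ b : B, (Polynomial.X + Polynomial.C (algebraMap F (AlgebraicClosure F)
        (b : F) * u 2))).degree = ((Fintype.card B : ℕ) : WithBot ℕ) := by
      rw [Polynomial.degree_prod]
      simp only [Polynomial.degree_X_add_C, Finset.sum_const, Finset.card_univ, nsmul_one]
    rw [Polynomial.degree_add_eq_left_of_degree_lt, hdeg]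
    · exact_mod_cast Fintype.card_ne_zero
    · rw [hdeg]
      exact Polynomial.degree_C_le.trans_lt (by exact_mod_cast Fintype.card_pos)
  have hz' : aeval ![u 0, z, u 2] (orbitForm B t) = u 1 := by
    rw [Polynomial.IsRoot.def] at hz
    simp only [h, Polynomial.eval_add, Polynomial.eval_prod, Polynomial.eval_X,
      Polynomial.eval_C] at hz
    simp only [orbitForm, map_add, map_prod, map_mul, map_pow, aeval_X, aeval_C, Matrix.cons_val]
    linear_combination hz
  have := congrArg (aeval ![u 0, z, u 2]) hf
  rw [orbitHom, map_zero, ← AlgHom.comp_apply, comp_aeval] at this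
  rw [map_zero, MvPolynomial.eval_map, ← aeval_def, ← this]
  congr 2
  ext i
  fin_cases i <;> simp [hz']

/-- The matrix fixing the first and third variable and adding `b` times the third to the second. -/
def shearMatrix (b : F) : Matrix (Fin 3) (Fin 3) F := !![1, 0, 0; 0, 1, b; 0, 0, 1]

lemma polyAct_upper (c a b d : F) : polyAct !![c, 0, 0; 0, a, b; 0, 0, d] =
    aeval ![C c * X 0, C a * X 1 + C b * X 2, C d * X 2] := by
  refine MvPolynomial.algHom_ext fun i => ?_
  rw [polyAct_X, aeval_X]
  fin_cases i <;> simp [Fin.sum_univ_three, smul_eq_C_mul]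

lemma polyAct_orbitForm {c a b d t : F} (ha : a ≠ 0) (hd : d ≠ 0) (hB : ∀ x ∈ B, d / a * x ∈ B)
    (ht : ∏ x : B, (b / a + x) + t * (d / a) ^ Fintype.card B = t) :
    polyAct !![c, 0, 0; 0, a, b; 0, 0, d] (orbitForm B t) =
      C (a ^ Fintype.card B) * orbitForm B t := by
  have hda : d / a ≠ 0 := div_ne_zero hd ha
  let e : B ≃ B := Equiv.ofBijective (fun x => ⟨d / a * x, hB x x.2⟩)
    (Finite.injective_iff_bijective.1 fun x y h =>
      Subtype.ext (mul_left_cancel₀ hda (congrArg Subtype.val h)))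
  have h1 : ∏ x : B, (C a * X 1 + C b * X 2 + C (x : F) * (C d * X 2) : MvPolynomial (Fin 3) F) =
      C a ^ Fintype.card B * ∏ x : B, (X 1 + C (b / a) * X 2 + mulX B x) := by
    rw [← Finset.card_univ, ← Finset.prod_const, ← Finset.prod_mul_distrib]
    refine Fintype.prod_equiv e _ _ fun x => ?_
    have hb : b = a * (b / a) := by field_simp
    have hx : (x : F) * d = a * (d / a * x) := by field_simp
    rw [mulX_apply, ← mul_assoc, ← C_mul, hx]
    nth_rw 1 [hb]
    simp only [e, Equiv.ofBijective_apply, C_mul]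
    ring
  have h2 : ∏ x : B, (C (b / a) * X 2 + mulX B x) =
      C (∏ x : B, (b / a + x)) * X 2 ^ Fintype.card B := by
    rw [← Finset.card_univ, ← Finset.prod_const, map_prod, ← Finset.prod_mul_distrib]
    simp only [mulX_apply, C_add, add_mul]
  have h3 : d ^ Fintype.card B = a ^ Fintype.card B * (d / a) ^ Fintype.card B := by
    rw [← mul_pow, mul_div_cancel₀ _ ha]
  have h4 : ∏ x : B, (b / a + x) = t - t * (d / a) ^ Fintype.card B := by
    linear_combination ht
  rw [polyAct_upper]
  simp only [orbitForm, map_add, map_prod, map_mul, map_pow, aeval_X, aeval_C, Matrix.cons_val,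
    algebraMap_eq]
  rw [h1, prod_add_add (mulX B) (mulX_injective B), h2, h4, mul_pow, ← map_pow C d, h3]
  simp only [mulX_apply, C_mul, C_sub, map_pow]
  ring

lemma polyAct_orbitHom {c a b d t : F} (ha : a ≠ 0) (hd : d ≠ 0) (hB : ∀ x ∈ B, d / a * x ∈ B)
    (ht : ∏ x : B, (b / a + x) + t * (d / a) ^ Fintype.card B = t) (f : MvPolynomial (Fin 3) F) :
    polyAct !![c, 0, 0; 0, a, b; 0, 0, d] (orbitHom B t f) =
      orbitHom B t (aeval (fun i => C (![c, a ^ Fintype.card B, d] i) * X i) f) := by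
  suffices (polyAct !![c, 0, 0; 0, a, b; 0, 0, d]).comp (orbitHom B t) = (orbitHom B t).comp
      (aeval (fun i => C (![c, a ^ Fintype.card B, d] i) * X i)) from congrArg (· f) this
  refine MvPolynomial.algHom_ext fun i => ?_
  have h := polyAct_orbitForm B (c := c) ha hd hB ht
  rw [polyAct_upper] at h ⊢
  simp only [AlgHom.comp_apply, orbitHom, aeval_X, map_mul, algHom_C, algebraMap_eq]
  fin_cases i
  · simp
  · exact h
  · simp

lemma polyAct_shearMatrix_orbitHom {b : F} (hb : b ∈ B) (t : F) (f : MvPolynomial (Fin 3) F) :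
    polyAct (shearMatrix b) (orbitHom B t f) = orbitHom B t f := by
  have h0 : ∏ x : B, (b / 1 + (x : F)) = 0 :=
    Finset.prod_eq_zero (Finset.mem_univ ⟨-b, B.neg_mem hb⟩) (by simp)
  refine (polyAct_orbitHom B one_ne_zero one_ne_zero (by simp) (by rw [h0]; simp) f).trans ?_
  suffices aeval (fun i => C (![1, 1 ^ Fintype.card B, 1] i) * X i) = AlgHom.id F
      (MvPolynomial (Fin 3) F) by rw [this, AlgHom.id_apply]
  refine MvPolynomial.algHom_ext fun i => ?_
  fin_cases i <;> simp

lemma mem_range_orbitHom {t : F} {f : MvPolynomial (Fin 3) F}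
    (hf : ∀ b ∈ B, polyAct (shearMatrix b) f = f) : f ∈ (orbitHom B t).range := by
  set A := (orbitHom B t).range
  have hX0 : X 0 ∈ A := ⟨X 0, by simp [orbitHom]⟩
  have hN : orbitForm B t ∈ A := ⟨X 1, by simp [orbitHom]⟩
  have hX2 : X 2 ∈ A := ⟨X 2, by simp [orbitHom]⟩
  let w : A := ⟨X 2, hX2⟩
  let μ : Polynomial A := ∏ b : B, (Polynomial.X + Polynomial.C (algebraMap F A b * w)) +
    Polynomial.C (algebraMap F A t * w ^ Fintype.card B - ⟨orbitForm B t, hN⟩)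
  have hmonic : (∏ b : B, (Polynomial.X + Polynomial.C (algebraMap F A b * w))).Monic :=
    Polynomial.monic_prod_of_monic _ _ fun b _ => Polynomial.monic_X_add_C _
  have hdeg : (∏ b : B, (Polynomial.X + Polynomial.C (algebraMap F A b * w))).degree =
      ((Fintype.card B : ℕ) : WithBot ℕ) := by
    rw [Polynomial.degree_prod]
    simp only [Polynomial.degree_X_add_C, Finset.sum_const, Finset.card_univ, nsmul_one]
  have hlt : (Polynomial.C (algebraMap F A t * w ^ Fintype.card B - ⟨orbitForm B t, hN⟩)).degree <
      (∏ b : B, (Polynomial.X + Polynomial.C (algebraMap F A b * w))).degree := by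
    rw [hdeg]
    exact Polynomial.degree_C_le.trans_lt (by exact_mod_cast Fintype.card_pos)
  have hμ : μ.Monic := hmonic.add_of_left hlt
  have hμdeg : μ.degree = ((Fintype.card B : ℕ) : WithBot ℕ) := by
    rw [Polynomial.degree_add_eq_left_of_degree_lt hlt, hdeg]
  have hroot : Polynomial.aeval (X 1 : MvPolynomial (Fin 3) F) μ = 0 := by
    simp only [μ, map_add, map_sub, map_prod, map_mul, map_pow, Polynomial.aeval_X,
      Polynomial.aeval_C]
    change ∏ b : B, (X 1 + C (b : F) * X 2) + (C t * X 2 ^ Fintype.card B - orbitForm B t) = 0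
    rw [orbitForm]
    ring
  have hsurj (f : MvPolynomial (Fin 3) F) : ∃ h : Polynomial A, Polynomial.aeval (X 1) h = f := by
    suffices ((Polynomial.aeval (X 1 : MvPolynomial (Fin 3) F)).restrictScalars F).range = ⊤ from
      (SetLike.ext_iff.1 this f).2 Algebra.mem_top
    rw [eq_top_iff, ← MvPolynomial.adjoin_range_X, Algebra.adjoin_le_iff]
    rintro _ ⟨i, rfl⟩
    fin_cases i
    · exact ⟨Polynomial.C ⟨X 0, hX0⟩, Polynomial.aeval_C _ _⟩
    · exact ⟨Polynomial.X, Polynomial.aeval_X _⟩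
    · exact ⟨Polynomial.C w, Polynomial.aeval_C _ _⟩
  obtain ⟨h, rfl⟩ := hsurj f
  set f := Polynomial.aeval (X 1 : MvPolynomial (Fin 3) F) h
  have hr : Polynomial.aeval (X 1) (h %ₘ μ) = f := Polynomial.aeval_modByMonic_eq_self_of_root hroot
  let τ (b : B) : MvPolynomial (Fin 3) F →ₐ[A] MvPolynomial (Fin 3) F :=
    { polyAct (shearMatrix (b : F)) with
      commutes' := by
        rintro ⟨_, g, rfl⟩
        exact polyAct_shearMatrix_orbitHom B b.2 t g }
  have hτ (b : B) : τ b (X 1) = X 1 + mulX B b := by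
    change polyAct (shearMatrix (b : F)) (X 1) = _
    rw [shearMatrix, polyAct_upper, aeval_X, mulX_apply]
    simp
  have hinj : Function.Injective fun b => (X 1 : MvPolynomial (Fin 3) F) + mulX B b :=
    fun b b' h => mulX_injective B (add_left_cancel h)
  have hconst : (h %ₘ μ).map (algebraMap A (MvPolynomial (Fin 3) F)) = Polynomial.C f := by
    classical
    refine Polynomial.eq_of_degree_sub_lt_of_eval_finset_eq
      (Finset.univ.image fun b => X 1 + mulX B b) ?_ ?_
    · rw [Finset.card_image_of_injective _ hinj, Finset.card_univ]
      refine (Polynomial.degree_sub_le _ _).trans_lt (max_lt ?_ ?_)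
      · rw [← hμdeg]
        exact Polynomial.degree_map_le.trans_lt (Polynomial.degree_modByMonic_lt h hμ)
      · exact Polynomial.degree_C_le.trans_lt (by exact_mod_cast Fintype.card_pos)
    · intro x hx
      obtain ⟨b, -, rfl⟩ := Finset.mem_image.1 hx
      rw [Polynomial.eval_map_algebraMap, ← hτ, Polynomial.aeval_algHom_apply, hr,
        Polynomial.eval_C]
      exact hf b b.2
  have := congrArg (Polynomial.coeff · 0) hconst
  simp only [Polynomial.coeff_map, Polynomial.coeff_C_zero] at this
  exact this ▸ ((h %ₘ μ).coeff 0).2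

end shears

section diagonal
variable {F : Type u} [Field F]

lemma coeff_aeval_C_mul_X {σ : Type*} [Fintype σ] (χ : σ → F) (α : σ →₀ ℕ) (f : MvPolynomial σ F) :
    coeff α (aeval (fun i => C (χ i) * X i : σ → MvPolynomial σ F) f) =
      (∏ i, χ i ^ α i) * coeff α f := by
  suffices (lcoeff F α).comp
      (aeval (fun i => C (χ i) * X i : σ → MvPolynomial σ F)).toLinearMap =
        (∏ i, χ i ^ α i) • lcoeff F α from LinearMap.congr_fun this f
  refine linearMap_ext_monomial fun β => ?_
  classical
  have : aeval (fun i => C (χ i) * X i : σ → MvPolynomial σ F) (monomial β (1 : F)) =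
      C (∏ i, χ i ^ β i) * monomial β 1 := by
    rw [aeval_monomial, map_one, one_mul, Finsupp.prod_fintype _ _ (by simp), map_prod,
      monomial_eq, C_1, one_mul, Finsupp.prod_fintype _ _ (by simp), ← Finset.prod_mul_distrib]
    simp only [mul_pow, map_pow]
  simp only [LinearMap.comp_apply, AlgHom.toLinearMap_apply, this, lcoeff_apply, coeff_C_mul,
    LinearMap.smul_apply, smul_eq_mul, coeff_monomial]
  split_ifs with h
  · rw [h]
  · rw [mul_zero, mul_zero]

lemma forall_aeval_C_mul_X_eq_iff {ι σ : Type*} [Fintype σ] {χ : ι → σ → F} {f : MvPolynomial σ F} :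
    (∀ g, aeval (fun i => C (χ g i) * X i : σ → MvPolynomial σ F) f = f) ↔
      f ∈ monomialSubalgebra F (weightMonoid χ) := by
  simp only [mem_monomialSubalgebra, mem_weightMonoid, MvPolynomial.ext_iff, coeff_aeval_C_mul_X,
    mem_support_iff]
  constructor
  · exact fun h α hα g => mul_right_cancel₀ hα ((h g α).trans (one_mul _).symm)
  · intro h g α
    by_cases hα : coeff α f = 0
    · rw [hα, mul_zero]
    · rw [h α hα g, one_mul]

end diagonal

section representation
variable {F : Type u} [Field F] {Γ : Type*} [Group Γ]
  {ρ : Γ →* Matrix (Fin 3) (Fin 3) F}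

/-- The representation `ρ` acts by block matrices with an upper triangular second block. -/
def IsUpperBlock (ρ : Γ →* Matrix (Fin 3) (Fin 3) F) : Prop :=
  ∀ g, ρ g = !![ρ g 0 0, 0, 0; 0, ρ g 1 1, ρ g 1 2; 0, 0, ρ g 2 2]

namespace IsUpperBlock

lemma mul (hρ : IsUpperBlock ρ) (g h : Γ) :
    ρ (g * h) 0 0 = ρ g 0 0 * ρ h 0 0 ∧ ρ (g * h) 1 1 = ρ g 1 1 * ρ h 1 1 ∧
      ρ (g * h) 1 2 = ρ g 1 1 * ρ h 1 2 + ρ g 1 2 * ρ h 2 2 ∧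
      ρ (g * h) 2 2 = ρ g 2 2 * ρ h 2 2 := by
  rw [map_mul, hρ g, hρ h]
  simp [Matrix.mul_apply, Fin.sum_univ_three]

lemma diag_pow (hρ : IsUpperBlock ρ) (g : Γ) (k : ℕ) (i : Fin 3) :
    ρ (g ^ k) i i = ρ g i i ^ k := by
  induction k with
  | zero => simp
  | succ k ih =>
    obtain ⟨h0, h1, -, h2⟩ := hρ.mul (g ^ k) g
    rw [pow_succ, pow_succ, ← ih]
    fin_cases i
    · exact h0
    · exact h1
    · exact h2

lemma div_mul_mem (hρ : IsUpperBlock ρ) {B : AddSubgroup F}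
    (hB : ∀ x, x ∈ B ↔ ∃ g, ρ g = shearMatrix x) {g : Γ} (ha : ρ g 1 1 ≠ 0) {x : F} (hx : x ∈ B) :
    ρ g 2 2 / ρ g 1 1 * x ∈ B := by
  obtain ⟨τ, hτ⟩ := (hB x).1 hx
  refine (hB _).2 ⟨g⁻¹ * τ * g, ?_⟩
  have h : ρ τ * ρ g = ρ g * shearMatrix (ρ g 2 2 / ρ g 1 1 * x) := by
    rw [hτ, hρ g, shearMatrix, shearMatrix]
    ext i j
    fin_cases i <;> fin_cases j <;> simp [Matrix.mul_apply, Fin.sum_univ_three]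
    field_simp
    ring
  rw [mul_assoc, map_mul, map_mul, h, ← mul_assoc, ← map_mul, inv_mul_cancel, map_one, one_mul]

lemma div_sub_div_mem (hρ : IsUpperBlock ρ) {B : AddSubgroup F}
    (hB : ∀ x, x ∈ B ↔ ∃ g, ρ g = shearMatrix x) {g h : Γ} (ha : ρ h 1 1 ≠ 0)
    (hgh : ∀ i, ρ g i i = ρ h i i) : ρ g 1 2 / ρ g 1 1 - ρ h 1 2 / ρ h 1 1 ∈ B := by
  refine (hB _).2 ⟨h⁻¹ * g, ?_⟩
  have : ρ g = ρ h * shearMatrix (ρ g 1 2 / ρ g 1 1 - ρ h 1 2 / ρ h 1 1) := by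
    rw [hgh 1, ← sub_div, hρ h, hρ g, hgh, hgh, hgh, shearMatrix]
    ext i j
    fin_cases i <;> fin_cases j <;> simp [Matrix.mul_apply, Fin.sum_univ_three]
    field_simp
    ring
  refine (map_mul ρ _ _).trans ((congrArg (ρ h⁻¹ * ·) this).trans ?_)
  rw [← mul_assoc, ← map_mul, inv_mul_cancel, map_one, one_mul]

/-- An additive cocycle correction: after subtracting a multiple of a power of the third variable,
the orbit form is an eigenvector. -/
lemma exists_correction (hρ : IsUpperBlock ρ) {B : AddSubgroup F} [Fintype B]
    (hB : ∀ x, x ∈ B ↔ ∃ g, ρ g = shearMatrix x) (ha : ∀ g, ρ g 1 1 ≠ 0) {m : ℕ}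
    (hm : (m : F) ≠ 0) (hpow : ∀ g i, ρ g i i ^ m = 1) :
    ∃ t, ∀ g, ∏ x : B, (ρ g 1 2 / ρ g 1 1 + x) +
      t * (ρ g 2 2 / ρ g 1 1) ^ Fintype.card B = t := by
  let Λ (z : F) : F := ∏ x : B, (z + x)
  have hadd (z w : F) : Λ (z + w) = Λ z + Λ w :=
    prod_add_add B.subtype Subtype.val_injective z w
  have hzero {z : F} (hz : z ∈ B) : Λ z = 0 :=
    Finset.prod_eq_zero (Finset.mem_univ ⟨-z, B.neg_mem hz⟩) (by simp)
  have hsmul (g : Γ) (hd : ρ g 2 2 ≠ 0) (z : F) :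
      Λ (ρ g 2 2 / ρ g 1 1 * z) = (ρ g 2 2 / ρ g 1 1) ^ Fintype.card B * Λ z := by
    let e : B ≃ B := Equiv.ofBijective (fun x => ⟨_, hρ.div_mul_mem hB (ha g) x.2⟩)
      (Finite.injective_iff_bijective.1 fun x y h =>
        Subtype.ext (mul_left_cancel₀ (div_ne_zero hd (ha g)) (congrArg Subtype.val h)))
    rw [← Finset.card_univ, ← Finset.prod_const, ← Finset.prod_mul_distrib]
    refine (Fintype.prod_equiv e _ _ fun x => ?_).symm
    simp only [e, Equiv.ofBijective_apply, mul_add]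
  have hd (g : Γ) : ρ g 2 2 ≠ 0 := fun h => by
    have := hpow g 2
    rw [h, zero_pow (by rintro rfl; simp at hm)] at this
    exact zero_ne_one this
  let μ (g : Γ) : F := Λ (ρ g 1 2 / ρ g 1 1)
  let s (g : Γ) : F := (ρ g 2 2 / ρ g 1 1) ^ Fintype.card B
  have hcongr {g h : Γ} (hgh : ∀ i, ρ g i i = ρ h i i) : μ g = μ h := by
    have := hadd (ρ g 1 2 / ρ g 1 1 - ρ h 1 2 / ρ h 1 1) (ρ h 1 2 / ρ h 1 1)
    rwa [sub_add_cancel, hzero (hρ.div_sub_div_mem hB (ha h) hgh), zero_add] at this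
  have hcocycle (g h : Γ) : μ (g * h) = μ h + s h * μ g := by
    rw [← hsmul h (hd h), ← hadd]
    simp only [μ]
    rw [(hρ.mul g h).2.1, (hρ.mul g h).2.2.1]
    congr 1
    have := ha g
    have := ha h
    field_simp
  have hcomm (g h : Γ) : μ (g * h) = μ (h * g) := hcongr fun i => by
    fin_cases i
    · exact (hρ.mul g h).1.trans ((mul_comm _ _).trans (hρ.mul h g).1.symm)
    · exact (hρ.mul g h).2.1.trans ((mul_comm _ _).trans (hρ.mul h g).2.1.symm)
    · exact (hρ.mul g h).2.2.2.trans ((mul_comm _ _).trans (hρ.mul h g).2.2.2.symm)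
  by_cases hs : ∃ h, s h ≠ 1
  · obtain ⟨h, hh⟩ := hs
    refine ⟨μ h / (1 - s h), fun g => ?_⟩
    change μ g + _ * s g = _
    have h1 : 1 - s h ≠ 0 := sub_ne_zero.2 hh.symm
    have h2 := hcomm g h
    rw [hcocycle, hcocycle] at h2
    field_simp
    linear_combination -h2
  · push Not at hs
    refine ⟨0, fun g => ?_⟩
    rw [zero_mul, add_zero]
    change μ g = 0
    have h1 : μ 1 = 0 := by simpa [hs] using hcocycle 1 1
    have hk (k : ℕ) : μ (g ^ k) = k * μ g := by
      induction k with
      | zero => simpa using h1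
      | succ k ih =>
        rw [pow_succ, hcocycle, hs, ih]
        push_cast
        ring
    have h2 : μ (g ^ m) = μ 1 := hcongr fun i => by simp [hρ.diag_pow, hpow]
    rw [hk, h1] at h2
    exact (mul_eq_zero.1 h2).resolve_left hm

theorem isGorensteinRing_invariantAlg_iff [Finite Γ] (hρ : IsUpperBlock ρ) (p : ℕ) [Fact p.Prime]
    [CharP F p] (hdet : ∀ g, ρ g 0 0 * ρ g 1 1 * ρ g 2 2 = 1) {B : AddSubgroup F} [Fintype B]
    (hB : ∀ x, x ∈ B ↔ ∃ g, ρ g = shearMatrix x) {n : ℕ} (hn : Fintype.card B = p ^ n) :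
    IsGorensteinRing (invariantAlg (Set.range ρ)) ↔ ∀ g, ρ g 1 1 ^ (p ^ n - 1) = 1 := by
  obtain ⟨k, m, hm, hkm⟩ := Nat.exists_eq_pow_mul_and_not_dvd (Nat.card_pos (α := Γ)).ne' p
    (Fact.out : p.Prime).ne_one
  have hpow (g i) : ρ g i i ^ m = 1 := by
    rw [← ExpChar.pow_prime_pow_mul_eq_one_iff p k, ← hkm, ← hρ.diag_pow, pow_card_eq_one']
    simp
  have ha (g) : ρ g 1 1 ≠ 0 := fun h => by simpa [h] using hdet g
  have hd (g) : ρ g 2 2 ≠ 0 := fun h => by simpa [h] using hdet g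
  obtain ⟨t, ht⟩ := hρ.exists_correction hB ha (m := m)
    (fun h => hm ((CharP.cast_eq_zero_iff F p m).1 h)) hpow
  set χ : Γ → Fin 3 → F := fun g => ![ρ g 0 0, ρ g 1 1 ^ p ^ n, ρ g 2 2]
  have hact (g : Γ) (f : MvPolynomial (Fin 3) F) : polyAct (ρ g) (orbitHom B t f) =
      orbitHom B t (aeval (fun i => C (χ g i) * X i) f) := by
    have := polyAct_orbitHom B (c := ρ g 0 0) (ha g) (hd g)
      (fun x hx => hρ.div_mul_mem hB (ha g) hx) (ht g) f
    rwa [← hρ g, hn] at this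
  have hmap : (monomialSubalgebra F (weightMonoid χ)).map (orbitHom B t) =
      invariantAlg (Set.range ρ) := by
    apply SetLike.ext
    intro f
    constructor
    · rintro ⟨f, hf, rfl⟩ _ ⟨g, rfl⟩
      exact (hact g f).trans (congrArg _ (forall_aeval_C_mul_X_eq_iff.2 hf g))
    · intro hf
      obtain ⟨f, rfl⟩ := mem_range_orbitHom B (t := t) (f := f) fun b hb => by
        obtain ⟨g, hg⟩ := (hB b).1 hb
        exact hf _ ⟨g, hg⟩
      refine ⟨f, forall_aeval_C_mul_X_eq_iff.1 fun g => orbitHom_injective B t ?_, rfl⟩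
      exact (hact g f).symm.trans (hf _ ⟨g, rfl⟩)
  have e : monomialSubalgebra F (weightMonoid χ) ≃+* invariantAlg (Set.range ρ) :=
    hmap ▸ ((monomialSubalgebra F (weightMonoid χ)).equivMapOfInjective _
      (orbitHom_injective B t)).toRingEquiv
  have hp := (Fact.out : p.Prime)
  rw [← isGorensteinRing_weightMonoid_iff (c := fun g => ρ g 0 0) (d := fun g => ρ g 2 2) hdet
    (Nat.pos_of_ne_zero (by rintro rfl; simp at hm)) (pow_pos hp.pos n)
    (((Nat.Prime.coprime_iff_not_dvd hp).2 hm).pow_left n) (hpow · 0) (hpow · 1) (hpow · 2)]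
  exact ⟨IsGorensteinRing.of_ringEquiv e.symm, IsGorensteinRing.of_ringEquiv e⟩

end IsUpperBlock
end representation

section conjugation
variable {F : Type u} [Field F]

lemma polyAct_one {m : ℕ} (f : MvPolynomial (Fin m) F) : polyAct 1 f = f := by
  suffices polyAct 1 = AlgHom.id F (MvPolynomial (Fin m) F) from congrArg (· f) this
  refine MvPolynomial.algHom_ext fun i => ?_
  simp [polyAct_X, Matrix.one_apply]

lemma polyAct_injective {m : ℕ} {E E' : Matrix (Fin m) (Fin m) F} (h : E * E' = 1) :
    Function.Injective (polyAct E) :=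
  Function.LeftInverse.injective (g := polyAct E') fun f => by rw [← polyAct_mul, h, polyAct_one]

lemma map_polyAct_invariantAlg {m : ℕ} {E E' : Matrix (Fin m) (Fin m) F} (h : E * E' = 1)
    (S : Set (Matrix (Fin m) (Fin m) F)) :
    (invariantAlg S).map (polyAct E) = invariantAlg ((fun M => E' * M * E) '' S) := by
  have h' : E' * E = 1 := mul_eq_one_comm.1 h
  have key (M : Matrix (Fin m) (Fin m) F) (f : MvPolynomial (Fin m) F) :
      polyAct (E' * M * E) (polyAct E f) = polyAct E (polyAct M f) := by
    rw [← polyAct_mul, ← polyAct_mul, ← mul_assoc, ← mul_assoc, h, one_mul]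
  apply SetLike.ext
  intro f
  constructor
  · rintro ⟨f, hf, rfl⟩ _ ⟨M, hM, rfl⟩
    exact (key M f).trans (congrArg _ (hf M hM))
  · intro hf
    have hE : polyAct E (polyAct E' f) = f := by rw [← polyAct_mul, h', polyAct_one]
    refine ⟨polyAct E' f, fun M hM => polyAct_injective h ?_, hE⟩
    rw [← key, hE]
    exact hf _ ⟨M, hM, rfl⟩

lemma isTransvectionMat_conj_iff {m : ℕ} {E E' M : Matrix (Fin m) (Fin m) F} (h : E * E' = 1) :
    IsTransvectionMat (E * M * E') ↔ IsTransvectionMat M := by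
  have h' : E' * E = 1 := mul_eq_one_comm.1 h
  have hE : IsUnit E := ⟨⟨E, E', h, h'⟩, rfl⟩
  have hE' : IsUnit E' := ⟨⟨E', E, h', h⟩, rfl⟩
  have h1 : E * M * E' - 1 = E * (M - 1) * E' := by
    rw [mul_sub, sub_mul, mul_one, h]
  have h2 : E * (M - 1) * E' * (E * (M - 1) * E') = E * ((M - 1) * (M - 1)) * E' := by
    simp only [mul_assoc]
    rw [← mul_assoc E' E, h', one_mul]
  rw [IsTransvectionMat, IsTransvectionMat, h1, h2,
    rank_mul_eq_left_of_isUnit_det _ _ ((isUnit_iff_isUnit_det _).1 hE'),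
    rank_mul_eq_right_of_isUnit_det _ _ ((isUnit_iff_isUnit_det _).1 hE), hE'.mul_left_eq_zero,
    hE.mul_right_eq_zero]

lemma shearMatrix_add (x y : F) : shearMatrix (x + y) = shearMatrix x * shearMatrix y := by
  simp only [shearMatrix]
  ext i j
  fin_cases i <;> fin_cases j <;> simp [Matrix.mul_apply, Fin.sum_univ_three, add_comm]

@[simp] lemma shearMatrix_zero : shearMatrix (0 : F) = 1 := by
  ext i j
  fin_cases i <;> fin_cases j <;> simp [shearMatrix]

lemma eq_shearMatrix_neg {M : Matrix (Fin 3) (Fin 3) F} {x : F} (h : M * shearMatrix x = 1) :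
    M = shearMatrix (-x) :=
  left_inv_eq_right_inv h (by rw [← shearMatrix_add, add_neg_cancel, shearMatrix_zero])

lemma shearMatrix_pow (x : F) (k : ℕ) : shearMatrix x ^ k = shearMatrix (k * x) := by
  induction k with
  | zero => simp
  | succ k ih => rw [pow_succ, ih, ← shearMatrix_add, Nat.cast_succ, add_one_mul]

lemma shearMatrix_injective : Function.Injective (shearMatrix (F := F)) := fun _ _ h => by
  simpa [shearMatrix] using congrFun (congrFun h 1) 2

lemma isTransvectionMat_shearMatrix {x : F} (hx : x ≠ 0) : IsTransvectionMat (shearMatrix x) := by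
  have h : shearMatrix x - 1 = vecMulVec ![0, x, 0] ![0, 0, 1] := by
    ext i j
    fin_cases i <;> fin_cases j <;> simp [shearMatrix, vecMulVec_apply]
  refine ⟨le_antisymm (h ▸ rank_vecMulVec_le _ _) (Nat.one_le_iff_ne_zero.2 fun h0 => hx ?_), ?_⟩
  · rw [rank, Submodule.finrank_eq_zero, LinearMap.range_eq_bot] at h0
    simpa [h, vecMulVec_apply, mulVec, dotProduct, Fin.sum_univ_three] using
      congrFun (LinearMap.congr_fun h0 (Pi.single 2 1)) 1
  · rw [h, vecMulVec_mul_vecMulVec]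
    simp

/-- The block diagonal matrix with blocks `1` and `P`. -/
def oneBlock (P : Matrix (Fin 2) (Fin 2) F) : Matrix (Fin 3) (Fin 3) F :=
  !![1, 0, 0; 0, P 0 0, P 0 1; 0, P 1 0, P 1 1]

lemma oneBlock_mul_oneBlock_eq_one {P Q : Matrix (Fin 2) (Fin 2) F} (h : P * Q = 1) :
    oneBlock P * oneBlock Q = 1 := by
  have h' (i j) := congrFun (congrFun h i) j
  simp only [Matrix.mul_apply, Fin.sum_univ_two] at h'
  ext i j
  fin_cases i <;> fin_cases j <;> simp [oneBlock, Matrix.mul_apply, Fin.sum_univ_three, h']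

lemma oneBlock_mul_mul_oneBlock (P : (Matrix (Fin 2) (Fin 2) F)ˣ)
    {g : Matrix.SpecialLinearGroup (Fin 3) F} (h : (g : Matrix (Fin 3) (Fin 3) F) 0 1 = 0 ∧
      (g : Matrix (Fin 3) (Fin 3) F) 0 2 = 0 ∧ (g : Matrix (Fin 3) (Fin 3) F) 1 0 = 0 ∧
      (g : Matrix (Fin 3) (Fin 3) F) 2 0 = 0) :
    oneBlock ↑P⁻¹ * (g : Matrix (Fin 3) (Fin 3) F) * oneBlock ↑P =
      !![(g : Matrix (Fin 3) (Fin 3) F) 0 0, 0, 0;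
        0, restrictW P g 0 0, restrictW P g 0 1; 0, restrictW P g 1 0, restrictW P g 1 1] := by
  obtain ⟨h1, h2, h3, h4⟩ := h
  ext i j
  fin_cases i <;> fin_cases j <;>
    simp [oneBlock, restrictW, subW, Matrix.mul_apply, vecMul, dotProduct, Fin.sum_univ_three,
      Fin.sum_univ_two, h1, h2, h3, h4]

end conjugation

section reducible
variable {F : Type u} [Field F]

lemma exists_inv_row_eq {w : Fin 2 → F} (hw : w ≠ 0) :
    ∃ P : (Matrix (Fin 2) (Fin 2) F)ˣ, (↑P⁻¹ : Matrix (Fin 2) (Fin 2) F) 1 = w := by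
  suffices ∃ v : Fin 2 → F, (Matrix.of ![v, w]).det ≠ 0 by
    obtain ⟨v, hv⟩ := this
    exact ⟨(GeneralLinearGroup.mkOfDetNeZero (Matrix.of ![v, w]) hv)⁻¹, by
      rw [inv_inv]; rfl⟩
  by_cases h0 : w 0 = 0
  · refine ⟨![1, 0], fun h => hw ?_⟩
    ext i
    fin_cases i
    · exact h0
    · simpa [det_fin_two] using h
  · exact ⟨![0, 1], by simpa [det_fin_two] using h0⟩

lemma restrictW_one_zero_eq_zero {P : (Matrix (Fin 2) (Fin 2) F)ˣ}
    {g : Matrix.SpecialLinearGroup (Fin 3) F}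
    (h : (↑P⁻¹ : Matrix (Fin 2) (Fin 2) F) 1 ᵥ* subW g ∈
      Submodule.span F {(↑P⁻¹ : Matrix (Fin 2) (Fin 2) F) 1}) : restrictW P g 1 0 = 0 := by
  obtain ⟨c, hc⟩ := Submodule.mem_span_singleton.1 h
  have h1 : restrictW P g 1 = (↑P⁻¹ : Matrix (Fin 2) (Fin 2) F) 1 ᵥ* subW g ᵥ* ↑P := rfl
  have h2 : (↑P⁻¹ : Matrix (Fin 2) (Fin 2) F) 1 ᵥ* ↑P =
    ((↑P⁻¹ : Matrix (Fin 2) (Fin 2) F) * (↑P : Matrix (Fin 2) (Fin 2) F)) 1 := rfl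
  rw [h1, ← hc, smul_vecMul, h2, P.inv_mul]
  simp

lemma IsTransvectionMat.eq_shearMatrix {M : Matrix (Fin 3) (Fin 3) F} {a b x c : F}
    (hM : M = !![a, 0, 0; 0, b, x; 0, 0, c]) (h : IsTransvectionMat M) : M = shearMatrix x := by
  have h' (i j) := congrFun (congrFun h.2 i) j
  have h0 := h' 0 0
  have h1 := h' 1 1
  have h2 := h' 2 2
  subst hM
  simp [Matrix.mul_apply, Fin.sum_univ_three, sub_eq_zero] at h0 h1 h2
  rw [h0, h1, h2, shearMatrix]

variable (G : Subgroup (Matrix.SpecialLinearGroup (Fin 3) F)) (P : (Matrix (Fin 2) (Fin 2) F)ˣ)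

/-- The representation of `G` on `F³`, conjugated by the change of basis `P` of `W`. -/
def conjRep : G →* Matrix (Fin 3) (Fin 3) F where
  toFun g := oneBlock ↑P⁻¹ * ((g : Matrix.SpecialLinearGroup (Fin 3) F) : Matrix (Fin 3) (Fin 3) F) *
    oneBlock ↑P
  map_one' := by
    simp [oneBlock_mul_oneBlock_eq_one, -coe_units_inv]
  map_mul' g h := by
    change oneBlock ↑P⁻¹ * (((g : Matrix.SpecialLinearGroup (Fin 3) F) :
      Matrix (Fin 3) (Fin 3) F) * ((h : Matrix.SpecialLinearGroup (Fin 3) F) :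
      Matrix (Fin 3) (Fin 3) F)) * oneBlock ↑P = _
    simp only [mul_assoc]
    rw [← mul_assoc (oneBlock (P : Matrix (Fin 2) (Fin 2) F)) (oneBlock _),
      oneBlock_mul_oneBlock_eq_one P.mul_inv, one_mul]

variable {G P}

lemma conjRep_apply (g : G) : conjRep G P g =
    oneBlock ↑P⁻¹ * ((g : Matrix.SpecialLinearGroup (Fin 3) F) : Matrix (Fin 3) (Fin 3) F) *
      oneBlock ↑P := rfl

lemma conjRep_injective : Function.Injective (conjRep G P) := by
  refine fun g h hgh => Subtype.ext (Subtype.ext ?_)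
  have h1 : IsUnit (oneBlock (↑P : Matrix (Fin 2) (Fin 2) F)) :=
    ⟨⟨_, _, oneBlock_mul_oneBlock_eq_one P.mul_inv, oneBlock_mul_oneBlock_eq_one P.inv_mul⟩, rfl⟩
  have h2 : IsUnit (oneBlock (↑P⁻¹ : Matrix (Fin 2) (Fin 2) F)) :=
    ⟨⟨_, _, oneBlock_mul_oneBlock_eq_one P.inv_mul, oneBlock_mul_oneBlock_eq_one P.mul_inv⟩, rfl⟩
  exact h2.mul_left_cancel (h1.mul_right_cancel hgh)

lemma det_conjRep (g : G) : (conjRep G P g).det = 1 := by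
  rw [conjRep_apply, det_mul_right_comm, oneBlock_mul_oneBlock_eq_one P.inv_mul, one_mul]
  exact g.1.2

lemma isTransvectionMat_conjRep_iff (g : G) : IsTransvectionMat (conjRep G P g) ↔
    IsTransvectionMat ((g : Matrix.SpecialLinearGroup (Fin 3) F) : Matrix (Fin 3) (Fin 3) F) :=
  isTransvectionMat_conj_iff (oneBlock_mul_oneBlock_eq_one P.inv_mul)

lemma isGorensteinRing_invariantRing_iff :
    IsGorensteinRing (invariantRing G) ↔
      IsGorensteinRing (invariantAlg (Set.range (conjRep G P))) := by
  have h := oneBlock_mul_oneBlock_eq_one P.mul_inv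
  have hmap : (invariantRing G).map (polyAct (oneBlock ↑P)) =
      invariantAlg (Set.range (conjRep G P)) := by
    rw [invariantRing, map_polyAct_invariantAlg h]
    congr 1
    ext M
    constructor
    · rintro ⟨_, ⟨g, hg, rfl⟩, rfl⟩
      exact ⟨⟨g, hg⟩, rfl⟩
    · rintro ⟨g, rfl⟩
      exact ⟨_, ⟨g, g.2, rfl⟩, rfl⟩
  have e : invariantRing G ≃+* invariantAlg (Set.range (conjRep G P)) :=
    hmap ▸ ((invariantRing G).equivMapOfInjective _ (polyAct_injective h)).toRingEquiv
  exact ⟨IsGorensteinRing.of_ringEquiv e, IsGorensteinRing.of_ringEquiv e.symm⟩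

lemma transSubgroup_le (G : Subgroup (Matrix.SpecialLinearGroup (Fin 3) F)) :
    transSubgroup G ≤ G :=
  (Subgroup.closure_le G).2 fun _ hg => hg.1

/-- The elements `g` of `G` whose conjugate by `P` is a shear are those of `T(G)`. -/
lemma mem_transSubgroup_iff
    (hG : ∀ g : G, IsTransvectionMat (conjRep G P g) → ∃ x, conjRep G P g = shearMatrix x) (g : G) :
    (g : Matrix.SpecialLinearGroup (Fin 3) F) ∈ transSubgroup G ↔
      ∃ x, conjRep G P g = shearMatrix x := by
  constructor
  · suffices ∀ g ∈ transSubgroup G, ∀ hg : g ∈ G, ∃ x, conjRep G P ⟨g, hg⟩ = shearMatrix x from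
      fun h => this g h g.2
    intro g hg
    induction hg using Subgroup.closure_induction with
    | mem g hg => exact fun h => hG _ ((isTransvectionMat_conjRep_iff ⟨g, h⟩).2 hg.2)
    | inv g hg ih =>
      intro h
      obtain ⟨x, hx⟩ := ih (transSubgroup_le G hg)
      refine ⟨-x, eq_shearMatrix_neg ?_⟩
      rw [← hx, ← map_mul, ← map_one (conjRep G P)]
      exact congrArg _ (Subtype.ext (inv_mul_cancel g))
    | one => exact fun h => ⟨0, by rw [shearMatrix_zero]; exact map_one _⟩
    | mul g g' hg hg' ih ih' =>
      intro h
      obtain ⟨x, hx⟩ := ih (transSubgroup_le G hg)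
      obtain ⟨x', hx'⟩ := ih' (transSubgroup_le G hg')
      exact ⟨x + x', by rw [shearMatrix_add, ← hx, ← hx', ← map_mul]; rfl⟩
  · rintro ⟨x, hx⟩
    rcases eq_or_ne x 0 with rfl | hx0
    · rw [shearMatrix_zero, ← map_one (conjRep G P)] at hx
      rw [conjRep_injective hx]
      exact one_mem _
    · refine Subgroup.subset_closure ⟨g.2, (isTransvectionMat_conjRep_iff (P := P) g).1 ?_⟩
      exact hx ▸ isTransvectionMat_shearMatrix hx0

end reducible

/-- Chapter A, case `W` a reducible `T(G)`-module: in a suitable basis of `W`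
the group `T(G)|W` is unipotent upper triangular and elementary abelian of order `p^n`, and
`S(V)^G` is Gorenstein iff every `g|W` is upper triangular `(a b; 0 d)` with `a^{pⁿ-1} = 1`. -/
theorem stmt6 (p : ℕ) [Fact p.Prime] (F : Type u) [Field F] [CharP F p]
    (G : Subgroup (Matrix.SpecialLinearGroup (Fin 3) F)) [Finite G]
    (hblock : ∀ g ∈ G, (g : Matrix (Fin 3) (Fin 3) F) 0 1 = 0 ∧
      (g : Matrix (Fin 3) (Fin 3) F) 0 2 = 0 ∧ (g : Matrix (Fin 3) (Fin 3) F) 1 0 = 0 ∧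
      (g : Matrix (Fin 3) (Fin 3) F) 2 0 = 0)
    (hT : transSubgroup G ≠ ⊥)
    (hred : ∃ w : Fin 2 → F, w ≠ 0 ∧
      ∀ τ ∈ transSubgroup G, w ᵥ* subW τ ∈ Submodule.span F ({w} : Set (Fin 2 → F))) :
    ∃ (P : (Matrix (Fin 2) (Fin 2) F)ˣ) (n : ℕ), 0 < n ∧
      (∀ τ ∈ transSubgroup G,
        restrictW P τ 0 0 = 1 ∧ restrictW P τ 1 1 = 1 ∧ restrictW P τ 1 0 = 0) ∧
      Nat.card ↥(transSubgroup G) = p ^ n ∧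
      (∀ τ₁ ∈ transSubgroup G, ∀ τ₂ ∈ transSubgroup G, τ₁ * τ₂ = τ₂ * τ₁) ∧
      (∀ τ ∈ transSubgroup G, τ ^ p = 1) ∧
      (IsGorensteinRing ↥(invariantRing G) ↔
        ∀ g ∈ G, restrictW P g 1 0 = 0 ∧ (restrictW P g 0 0) ^ (p ^ n - 1) = 1) := by
  obtain ⟨w, hw, hspan⟩ := hred
  obtain ⟨P, rfl⟩ := exists_inv_row_eq hw
  set ρ := conjRep G P with hρdef
  have hρ (g : G) : ρ g = !![(g : Matrix.SpecialLinearGroup (Fin 3) F) 0 0, 0, 0;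
      0, restrictW P g 0 0, restrictW P g 0 1; 0, restrictW P g 1 0, restrictW P g 1 1] :=
    oneBlock_mul_mul_oneBlock P (hblock g g.2)
  have hG (g : G) (hg : IsTransvectionMat (ρ g)) : ∃ x, ρ g = shearMatrix x := by
    have hgT : (g : Matrix.SpecialLinearGroup (Fin 3) F) ∈ transSubgroup G :=
      Subgroup.subset_closure ⟨g.2, (isTransvectionMat_conjRep_iff g).1 hg⟩
    exact ⟨_, hg.eq_shearMatrix (restrictW_one_zero_eq_zero (hspan g hgT) ▸ hρ g)⟩
  have hTiff := mem_transSubgroup_iff hG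
  have hle := transSubgroup_le G
  have hfin : Finite (transSubgroup G) := Finite.of_injective _ (Subgroup.inclusion_injective hle)
  have hTshear {τ} (hτ : τ ∈ transSubgroup G) : ∃ x, ρ ⟨τ, hle hτ⟩ = shearMatrix x :=
    (hTiff ⟨τ, hle hτ⟩).1 hτ
  have h10 (g : G) : restrictW P g 1 0 = 0 := by
    obtain ⟨⟨τ, hτ⟩, hτ1⟩ := Subgroup.ne_bot_iff_exists_ne_one.1 hT
    obtain ⟨x, hx⟩ := hTshear hτ
    have hx0 : x ≠ 0 := by
      rintro rfl
      rw [shearMatrix_zero, ← map_one ρ] at hx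
      exact hτ1 (Subtype.ext (congrArg Subtype.val (conjRep_injective hx)))
    obtain ⟨y, hy⟩ := hG (g * ⟨τ, hle hτ⟩ * g⁻¹) <| by
      rw [map_mul, map_mul, isTransvectionMat_conj_iff (by rw [← map_mul, mul_inv_cancel, map_one]),
        hx]
      exact isTransvectionMat_shearMatrix hx0
    have h : ρ g * shearMatrix x = shearMatrix y * ρ g := by
      rw [← hx, ← hy, ← map_mul, ← map_mul, inv_mul_cancel_right]
    have h22 := congrFun (congrFun h 2) 2
    rw [hρ g] at h22
    simpa [shearMatrix, Matrix.mul_apply, Fin.sum_univ_three, hx0] using h22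
  have hupper : IsUpperBlock ρ := fun g => by
    rw [hρ g, h10 g]
    rfl
  let B : AddSubgroup F :=
    { carrier := {x | ∃ g, ρ g = shearMatrix x}
      zero_mem' := ⟨1, by rw [map_one, shearMatrix_zero]⟩
      add_mem' := fun ⟨g, hg⟩ ⟨h, hh⟩ => ⟨g * h, by rw [map_mul, hg, hh, shearMatrix_add]⟩
      neg_mem' := fun ⟨g, hg⟩ => ⟨g⁻¹, eq_shearMatrix_neg <| by
        rw [← hg, ← map_mul, inv_mul_cancel, map_one]⟩ }
  let e : transSubgroup G ≃ B := Equiv.ofBijective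
    (fun τ => ⟨(hTshear τ.2).choose, ⟨τ, hle τ.2⟩, (hTshear τ.2).choose_spec⟩) <| by
    constructor
    · intro τ σ h
      have h' := (hTshear τ.2).choose_spec.trans
        ((congrArg shearMatrix (Subtype.ext_iff.1 h)).trans (hTshear σ.2).choose_spec.symm)
      exact Subtype.ext (congrArg Subtype.val (conjRep_injective h'))
    · rintro ⟨x, g, hg⟩
      have hgT := (hTiff g).2 ⟨x, hg⟩
      exact ⟨⟨g, hgT⟩, Subtype.ext
        (shearMatrix_injective ((hTshear hgT).choose_spec.symm.trans hg))⟩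
  have hpow : ∀ τ ∈ transSubgroup G, τ ^ p = 1 := fun τ hτ => by
    obtain ⟨x, hx⟩ := hTshear hτ
    refine congrArg Subtype.val (conjRep_injective (P := P) (a₁ := ⟨τ, hle hτ⟩ ^ p) (a₂ := 1) ?_)
    rw [map_pow, ← hρdef, hx, shearMatrix_pow, CharP.cast_eq_zero, zero_mul, shearMatrix_zero,
      map_one]
  obtain ⟨n, hn⟩ := IsPGroup.iff_card.1 (show IsPGroup p (transSubgroup G) from
    fun τ => ⟨1, Subtype.ext (by simpa using hpow τ τ.2)⟩)
  have := Finite.of_equiv _ e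
  have := Fintype.ofFinite B
  have hB : Fintype.card B = p ^ n := by rw [← hn, Nat.card_congr e, Nat.card_eq_fintype_card]
  refine ⟨P, n, ?_, fun τ hτ => ?_, hn, fun τ₁ h₁ τ₂ h₂ => ?_, hpow, ?_⟩
  · refine Nat.pos_of_ne_zero fun hn0 => hT ?_
    rw [hn0, pow_zero] at hn
    exact Subgroup.card_eq_one.1 hn
  · obtain ⟨x, hx⟩ := hTshear hτ
    rw [hρ] at hx
    refine ⟨?_, ?_, h10 ⟨τ, hle hτ⟩⟩
    · simpa [shearMatrix] using congrFun (congrFun hx 1) 1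
    · simpa [shearMatrix] using congrFun (congrFun hx 2) 2
  · obtain ⟨x₁, hx₁⟩ := hTshear h₁
    obtain ⟨x₂, hx₂⟩ := hTshear h₂
    refine congrArg Subtype.val (conjRep_injective (P := P)
      (a₁ := ⟨τ₁, hle h₁⟩ * ⟨τ₂, hle h₂⟩) (a₂ := ⟨τ₂, hle h₂⟩ * ⟨τ₁, hle h₁⟩) ?_)
    rw [map_mul, map_mul, ← hρdef, hx₁, hx₂, ← shearMatrix_add, ← shearMatrix_add, add_comm]
  · have hdet (g : G) : ρ g 0 0 * ρ g 1 1 * ρ g 2 2 = 1 := by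
      have h := det_conjRep (P := P) g
      rw [← hρdef, det_fin_three, hupper g] at h
      simpa using h
    rw [isGorensteinRing_invariantRing_iff (P := P),
      hupper.isGorensteinRing_invariantAlg_iff p hdet (B := B) (fun _ => Iff.rfl) hB]
    have h11 (g : G) : ρ g 1 1 = restrictW P g 0 0 := by rw [hρ]; rfl
    simp only [h11, Subtype.forall]
    exact forall₂_congr fun g hg => (and_iff_right (h10 ⟨g, hg⟩)).symm

end
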